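/- Let (A,X) ~ RDPG(F,n) for a d-dimensional inner product distribution F, and let U, S, Û be the rank-d spectral factors of P = XXᵀ and of A. There exist constants C > 0 such that for all suitably large n, with probability at least 1 − Cn^{-2} there exists an orthogonal matrix Q ∈ ℝ^{d×d} with ‖ÛQ − U‖_F ≤ C log^{1/2} n / √n. -/

import Mathlib

open MeasureTheory Filter Matrix
open scoped BigOperators NNReal ENNReal Topology Classical

noncomputable section

/-- Dot product on `Fin d → ℝ`. -/
def dotd {d : ℕ} (x y : Fin d → ℝ) : ℝ := ∑ k, x k * y k

/-- Euclidean norm on `Fin d → ℝ`. -/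
def euclNorm {d : ℕ} (x : Fin d → ℝ) : ℝ := Real.sqrt (∑ k, (x k) ^ 2)

/-- Support of a measure on a topological space. -/
def msupport {α : Type*} [TopologicalSpace α] [MeasurableSpace α] (μ : Measure α) : Set α :=
  {x | ∀ U : Set α, IsOpen U → x ∈ U → 0 < μ U}

/-- `F` is a `d`-dimensional inner product distribution. -/
def InnerProductDistribution (d : ℕ) (F : Measure (Fin d → ℝ)) : Prop :=
  IsProbabilityMeasure F ∧
    ∀ x ∈ msupport F, ∀ y ∈ msupport F, 0 ≤ dotd x y ∧ dotd x y ≤ 1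

/-- Auxiliary i.i.d. uniform randomness on `[0,1]`, indexed by pairs of vertices. -/
def pairUniform (n : ℕ) : Measure ((Fin n × Fin n) → ℝ) :=
  Measure.pi fun _ => volume.restrict (Set.Icc (0:ℝ) 1)

/-- The adjacency matrix built from latent positions `X`, sparsity scale `ρ`, and auxiliary
uniform variables `u`: conditional on `X`, the entries above the diagonal are independent
`Bernoulli(ρ ⟨X i, X j⟩)`, and the matrix is symmetric and hollow. -/
def adjOf {d n : ℕ} (ρ : ℝ) (X : Fin n → Fin d → ℝ) (u : (Fin n × Fin n) → ℝ) :
    Fin n → Fin n → ℝ := fun i j =>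
  if i = j then 0 else if u (min i j, max i j) < ρ * dotd (X i) (X j) then 1 else 0

/-- The joint law of `(A, X)` for a (possibly sparse) random dot product graph whose latent
positions have joint law `μX`. -/
def rdpgLawOf {d n : ℕ} (ρ : ℝ) (μX : Measure (Fin n → Fin d → ℝ)) :
    Measure ((Fin n → Fin n → ℝ) × (Fin n → Fin d → ℝ)) :=
  Measure.map (fun p => (adjOf ρ p.2 p.1, p.2)) ((pairUniform n).prod μX)

/-- The joint law of `(A,X) ~ RDPG(F, n)`. -/
def rdpgLaw (d n : ℕ) (F : Measure (Fin d → ℝ)) [SigmaFinite F] :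
    Measure ((Fin n → Fin n → ℝ) × (Fin n → Fin d → ℝ)) :=
  rdpgLawOf 1 (Measure.pi fun _ : Fin n => F)

/-- `(A, X) ~ RDPG(F, n)` for random variables `A, X` on a probability space `(Ω, P)`. -/
def HasRDPGLaw {Ω : Type*} [MeasurableSpace Ω] (P : Measure Ω) {d n : ℕ}
    (F : Measure (Fin d → ℝ)) [SigmaFinite F] (A : Ω → Fin n → Fin n → ℝ)
    (X : Ω → Fin n → Fin d → ℝ) : Prop :=
  Measure.map (fun ω => (A ω, X ω)) P = rdpgLaw d n F

/-- The marginal law of the adjacency matrix of an `RDPG(F,n)`. -/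
def adjLaw (d n : ℕ) (F : Measure (Fin d → ℝ)) [SigmaFinite F] :
    Measure (Fin n → Fin n → ℝ) :=
  (rdpgLaw d n F).map Prod.fst

/-- The law of the adjacency matrix for fixed latent positions `x`. -/
def adjLawFixed {d : ℕ} (n : ℕ) (x : Fin n → Fin d → ℝ) : Measure (Fin n → Fin n → ℝ) :=
  Measure.map (fun u => adjOf 1 x u) (pairUniform n)

/-- `Xh` is an adjacency spectral embedding of `A` into dimension `d`: its columns are
orthonormal eigenvectors of `A` corresponding to the `d` largest-in-magnitude eigenvalues,
scaled by the square roots of the absolute eigenvalues. -/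
def IsASE {n d : ℕ} (A : Fin n → Fin n → ℝ) (Xh : Fin n → Fin d → ℝ) : Prop :=
  ∃ (lam : Fin d → ℝ) (U : Fin n → Fin d → ℝ),
    (∀ j j', (∑ i, U i j * U i j') = if j = j' then (1:ℝ) else 0) ∧
    (∀ j, (Matrix.of A).mulVec (fun i => U i j) = fun i => lam j * U i j) ∧
    (∀ (mu : ℝ) (v : Fin n → ℝ), v ≠ 0 → (Matrix.of A).mulVec v = mu • v →
      (∀ j, (∑ i, v i * U i j) = 0) → ∀ j, |mu| ≤ |lam j|) ∧
    (∀ i j, Xh i j = U i j * Real.sqrt |lam j|)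

/-- A choice of adjacency spectral embedding of `A` into dimension `d`. -/
def ase (d : ℕ) {n : ℕ} (A : Fin n → Fin n → ℝ) : Fin n → Fin d → ℝ :=
  if h : ∃ Xh, IsASE A Xh then h.choose else 0

/-- The U-statistic with kernel `h` of the points `Y 1, …, Y n`. -/
def Ustat {d : ℕ} (m n : ℕ) (h : (Fin m → Fin d → ℝ) → ℝ) (Y : Fin n → Fin d → ℝ) : ℝ :=
  ((n.choose m : ℝ))⁻¹ * ∑ c : Fin m → Fin n,
    if StrictMono c then h (fun k => Y (c k)) else 0

/-- The weighted (bootstrapped) U-statistic with kernel `h` and weights `W` (indexed by the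
strictly increasing `m`-tuples). -/
def UstatW {d : ℕ} (m n : ℕ) (h : (Fin m → Fin d → ℝ) → ℝ)
    (W : (Fin m → Fin n) → ℝ) (Y : Fin n → Fin d → ℝ) : ℝ :=
  ((n.choose m : ℝ))⁻¹ * ∑ c : Fin m → Fin n,
    if StrictMono c then W c * h (fun k => Y (c k)) else 0

/-- `max_{c ∈ C^n_m} |W c|`. -/
def maxAbsWeight {m n : ℕ} (W : (Fin m → Fin n) → ℝ) : ℝ :=
  ⨆ c : Fin m → Fin n, if StrictMono c then |W c| else 0

/-- `h` is symmetric in its `m` arguments. -/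
def SymmetricKernel {d m : ℕ} (h : (Fin m → Fin d → ℝ) → ℝ) : Prop :=
  ∀ (σ : Equiv.Perm (Fin m)) (x : Fin m → Fin d → ℝ), h (x ∘ σ) = h x

/-- Assumption H1: `h` is invariant under simultaneous orthogonal transformation of
its arguments. -/
def AssumptionH1 {d m : ℕ} (h : (Fin m → Fin d → ℝ) → ℝ) : Prop :=
  ∀ Q : Matrix (Fin d) (Fin d) ℝ, Qᵀ * Q = 1 →
    ∀ x : Fin m → Fin d → ℝ, h (fun k => Q.mulVec (x k)) = h x

/-- Assumption H2 relative to a set `K₀ ⊆ ℝ^d`: viewing `h` as a function on `ℝ^{md}`,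
`h` is twice continuously differentiable on an open neighborhood `S` of `K₀^m` on which its
Hessian is bounded in norm, and the Hessian is continuous on the closure of `K₀^m`. -/
def AssumptionH2On {d m : ℕ} (K₀ : Set (Fin d → ℝ)) (h : (Fin m → Fin d → ℝ) → ℝ) : Prop :=
  ∃ S : Set (Fin m → Fin d → ℝ), IsOpen S ∧ {x | ∀ k, x k ∈ K₀} ⊆ S ∧
    ContDiffOn ℝ 2 h S ∧
    ContinuousOn (iteratedFDeriv ℝ 2 h) (closure {x | ∀ k, x k ∈ K₀}) ∧
    ∃ C : ℝ, ∀ x ∈ S, ‖iteratedFDeriv ℝ 2 h x‖ ≤ C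

/-- Assumption H2 for an RDPG with latent position distribution `F`. -/
def AssumptionH2 {d m : ℕ} (F : Measure (Fin d → ℝ)) (h : (Fin m → Fin d → ℝ) → ℝ) : Prop :=
  AssumptionH2On (msupport F) h

/-- `θ(F) = E h(X₁, …, X_m)` for `X₁, …, X_m` i.i.d. `F`. -/
def thetaOf {d : ℕ} (m : ℕ) (F : Measure (Fin d → ℝ)) [SigmaFinite F]
    (h : (Fin m → Fin d → ℝ) → ℝ) : ℝ :=
  ∫ x, h x ∂(Measure.pi fun _ : Fin m => F)

/-- The conditional expectation kernel `h₁(z) = E h(z, X₂, …, X_m)`. -/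
def kern1 {d : ℕ} (m : ℕ) (hm : 0 < m) (F : Measure (Fin d → ℝ)) [SigmaFinite F]
    (h : (Fin m → Fin d → ℝ) → ℝ) (z : Fin d → ℝ) : ℝ :=
  ∫ x, h (Function.update x (⟨0, hm⟩ : Fin m) z) ∂(Measure.pi fun _ : Fin m => F)

/-- `ζ₁ = E (E[h(X₁,…,X_m) ∣ X₁] − θ)²`. -/
def zeta1 {d : ℕ} (m : ℕ) (hm : 0 < m) (F : Measure (Fin d → ℝ)) [SigmaFinite F]
    (h : (Fin m → Fin d → ℝ) → ℝ) : ℝ :=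
  ∫ z, (kern1 m hm F h z - thetaOf m F h) ^ 2 ∂F

/-- Weak convergence (convergence in distribution) of a sequence of real random variables
`T n` on `(Ω, P)` to the law `μ`, tested against bounded continuous functions. -/
def TendstoInDistribution {Ω : Type*} [MeasurableSpace Ω] (P : Measure Ω)
    (T : ℕ → Ω → ℝ) (μ : Measure ℝ) : Prop :=
  ∀ g : BoundedContinuousFunction ℝ ℝ,
    Tendsto (fun n => ∫ ω, g (T n ω) ∂P) atTop (𝓝 (∫ x, g x ∂μ))

/-- The uniform distribution on `Fin n`. -/
def uniformFin (n : ℕ) : Measure (Fin n) := ((n : ℝ≥0))⁻¹ • Measure.count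

/-- The empirical distribution of the points `Y 1, …, Y n`. -/
def empMeasure {d n : ℕ} (Y : Fin n → Fin d → ℝ) : Measure (Fin d → ℝ) :=
  ((n : ℝ≥0))⁻¹ • ∑ i : Fin n, Measure.dirac (Y i)

instance {d n : ℕ} (Y : Fin n → Fin d → ℝ) : IsFiniteMeasure (empMeasure Y) := by
  unfold empMeasure; infer_instance

/-- The law of the bootstrapped network `Â*`: having observed `A ~ RDPG(F,n)` (in its
adjacency marginal), draw `Â* ~ RDPG(F̂_n, n)` where `F̂_n` is the empirical distribution
of the rows of the adjacency spectral embedding of `A`. -/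
def bootLaw (d n : ℕ) (F : Measure (Fin d → ℝ)) [SigmaFinite F] :
    Measure (Fin n → Fin n → ℝ) :=
  (adjLaw d n F).bind fun a => adjLaw d n (empMeasure (ase d a))

/-- `ρ̂ = binom(n,2)⁻¹ Σ_{i<j} A_{ij}`, the empirical edge density. -/
def rhoHat {n : ℕ} (A : Fin n → Fin n → ℝ) : ℝ :=
  ((n.choose 2 : ℝ))⁻¹ * ∑ i, ∑ j, if i < j then A i j else 0

/-- The (normalized) average degree. -/
def avgDegree {n : ℕ} (A : Fin n → Fin n → ℝ) : ℝ :=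
  (n : ℝ)⁻¹ * ∑ i, (∑ j, if j ≠ i then A i j else 0) / ((n : ℝ) - 1)

/-- The subgraph-counting kernel `h_R` associated with a graph `R` on `m` vertices. -/
def subgraphKernel {m : ℕ} (d : ℕ) (R : SimpleGraph (Fin m)) (x : Fin m → Fin d → ℝ) : ℝ :=
  ((Nat.card {G : SimpleGraph (Fin m) // Nonempty (G ≃g R)} : ℝ))⁻¹ *
    ∑ τ : Equiv.Perm (Fin m), ∏ p : Fin m × Fin m,
      if p.1 < p.2 then
        (if R.Adj p.1 p.2 then dotd (x (τ p.1)) (x (τ p.2))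
          else 1 - dotd (x (τ p.1)) (x (τ p.2)))
      else 1

/-- The empirical subgraph density `P̂(R)` of `R` in the graph with adjacency matrix `A`:
the proportion of `m`-subsets of vertices whose induced subgraph is isomorphic to `R`. -/
def subgraphDensity {m n : ℕ} (R : SimpleGraph (Fin m)) (A : Fin n → Fin n → ℝ) : ℝ :=
  ((n.choose m : ℝ))⁻¹ * ∑ c : Fin m → Fin n,
    if StrictMono c ∧ (∃ σ : Equiv.Perm (Fin m), ∀ k l : Fin m, k ≠ l →
        (A (c (σ k)) (c (σ l)) = 1 ↔ R.Adj k l)) then (1:ℝ) else 0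

/-- The entrywise ℓ¹ norm of a matrix. -/
def matL1 {n : ℕ} (M : Fin n → Fin n → ℝ) : ℝ := ∑ i, ∑ j, |M i j|

/-- The graph matching distance between two `n`-vertex graphs. -/
def dGM {n : ℕ} (A B : Fin n → Fin n → ℝ) : ℝ :=
  ⨅ σ : Equiv.Perm (Fin n),
    ((n.choose 2 : ℝ))⁻¹ * (∑ i, ∑ j, |A i j - B (σ i) (σ j)|) / 2

/-- The set of couplings of two measures. -/
def Couplings {α β : Type*} [MeasurableSpace α] [MeasurableSpace β]
    (μ : Measure α) (ν : Measure β) : Set (Measure (α × β)) :=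
  {γ | IsProbabilityMeasure γ ∧ γ.map Prod.fst = μ ∧ γ.map Prod.snd = ν}

/-- `W_{GM,p}^p`: the `p`-th power of the graph-matching Wasserstein distance between two
laws of random adjacency matrices. -/
def WGMpow {n : ℕ} (p : ℝ) (μ ν : Measure (Fin n → Fin n → ℝ)) : ℝ :=
  sInf ((fun γ => ∫ q, dGM q.1 q.2 ^ p ∂γ) '' Couplings μ ν)

/-- The Wasserstein `p`-distance between two distributions on `ℝ^d` (with Euclidean cost). -/
def wassersteinP {d : ℕ} (p : ℝ) (μ ν : Measure (Fin d → ℝ)) : ℝ :=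
  sInf ((fun γ => (∫ q, euclNorm (q.1 - q.2) ^ p ∂γ) ^ (1/p)) '' Couplings μ ν)

/-- `d̊_p(F₁,F₂) = min_{Q ∈ O(d)} d_p(F₁, F₂ ∘ Q)`. -/
def ringWasserstein {d : ℕ} (p : ℝ) (μ ν : Measure (Fin d → ℝ)) : ℝ :=
  sInf {r | ∃ Q : Matrix (Fin d) (Fin d) ℝ, Qᵀ * Q = 1 ∧
    r = wassersteinP p μ (ν.map fun x => Q.mulVec x)}

/-- The Frobenius norm of a matrix. -/
def frobNorm {n d : ℕ} (M : Matrix (Fin n) (Fin d) ℝ) : ℝ :=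
  Real.sqrt (∑ i, ∑ j, (M i j) ^ 2)

/-- The `2→∞` norm of a matrix: the maximum Euclidean norm of a row. -/
def twoInftyNorm {n d : ℕ} (M : Matrix (Fin n) (Fin d) ℝ) : ℝ := ⨆ i, euclNorm (M i)

/-- `U`, `lam` form a rank-`d` spectral decomposition of the symmetric matrix `Pm`:
the columns of `U` are orthonormal eigenvectors with eigenvalues `lam`, and
`Pm = U · diag(lam) · Uᵀ`. -/
def IsSpecDecomp {n d : ℕ} (Pm : Fin n → Fin n → ℝ) (U : Fin n → Fin d → ℝ)
    (lam : Fin d → ℝ) : Prop :=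
  (∀ j j', (∑ i, U i j * U i j') = if j = j' then (1:ℝ) else 0) ∧
  (∀ j, (Matrix.of Pm).mulVec (fun i => U i j) = fun i => lam j * U i j) ∧
  (∀ i i', Pm i i' = ∑ j, U i j * lam j * U i' j)

/-- `U`, `lam` are orthonormal eigenvectors of `A` for its `d` largest-in-magnitude
eigenvalues. -/
def IsTopSpec {n d : ℕ} (A : Fin n → Fin n → ℝ) (U : Fin n → Fin d → ℝ)
    (lam : Fin d → ℝ) : Prop :=
  (∀ j j', (∑ i, U i j * U i j') = if j = j' then (1:ℝ) else 0) ∧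
  (∀ j, (Matrix.of A).mulVec (fun i => U i j) = fun i => lam j * U i j) ∧
  (∀ (mu : ℝ) (v : Fin n → ℝ), v ≠ 0 → (Matrix.of A).mulVec v = mu • v →
    (∀ j, (∑ i, v i * U i j) = 0) → ∀ j, |mu| ≤ |lam j|)

/-- The `2→∞` bound with constant `C`: `max_i ‖Qᵀ Xh_i − X_i‖ ≤ C log n / √n`. -/
def TwoToInftyBound {n d : ℕ} (C : ℝ) (Xh X : Fin n → Fin d → ℝ)
    (Q : Matrix (Fin d) (Fin d) ℝ) : Prop :=
  ∀ i, euclNorm (Qᵀ.mulVec (Xh i) - X i) ≤ C * Real.log n / Real.sqrt n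

/-- The second moment matrix `Δ = E X₁ X₁ᵀ` of a distribution `F` on `ℝ^d`. -/
def secondMoment {d : ℕ} (F : Measure (Fin d → ℝ)) : Matrix (Fin d) (Fin d) ℝ :=
  Matrix.of fun i j => ∫ x, x i * x j ∂F


/-! ### Deterministic linear algebra -/

theorem dk_spectral {n : ℕ} (T : Matrix (Fin n) (Fin n) ℝ) (hT : Tᵀ = T) :
    ∃ (V : Matrix (Fin n) (Fin n) ℝ) (D : Fin n → ℝ), Vᵀ * V = 1 ∧ V * Vᵀ = 1 ∧
      T = V * Matrix.diagonal D * Vᵀ := by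
  have hH : T.IsHermitian := by
    rw [Matrix.IsHermitian, Matrix.conjTranspose_eq_transpose_of_trivial]; exact hT
  refine ⟨hH.eigenvectorUnitary, hH.eigenvalues, ?_, ?_, ?_⟩
  · have := Unitary.coe_star_mul_self hH.eigenvectorUnitary
    rwa [Matrix.star_eq_conjTranspose, Matrix.conjTranspose_eq_transpose_of_trivial] at this
  · have := Unitary.coe_mul_star_self hH.eigenvectorUnitary
    rwa [Unitary.coe_star, Matrix.star_eq_conjTranspose, Matrix.conjTranspose_eq_transpose_of_trivial] at this
  · have := hH.spectral_theorem
    rw [Unitary.conjStarAlgAut_apply, Matrix.star_eq_conjTranspose,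
      Matrix.conjTranspose_eq_transpose_of_trivial] at this
    exact this

theorem dk_diag_quad {n : ℕ} (V : Matrix (Fin n) (Fin n) ℝ) (D x : Fin n → ℝ) :
    x ⬝ᵥ ((V * Matrix.diagonal D * Vᵀ) *ᵥ x) = ∑ i, D i * ((Vᵀ *ᵥ x) i) ^ 2 := by
  rw [← Matrix.mulVec_mulVec, ← Matrix.mulVec_mulVec, Matrix.dotProduct_mulVec,
    ← Matrix.mulVec_transpose]
  simp only [dotProduct, Matrix.mulVec_diagonal]
  refine Finset.sum_congr rfl fun i _ => by ring

theorem dk_orth_sq {n : ℕ} (V : Matrix (Fin n) (Fin n) ℝ) (x : Fin n → ℝ) (hV : V * Vᵀ = 1) :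
    x ⬝ᵥ x = ∑ i, ((Vᵀ *ᵥ x) i) ^ 2 := by
  have := dk_diag_quad V (fun _ => 1) x
  simp only [Matrix.diagonal_one, Matrix.mul_one, hV, Matrix.one_mulVec, one_mul] at this
  exact this

/-- Quadratic form bound from eigenvalue bound. -/
theorem dk_quad_le {n : ℕ} (B : Matrix (Fin n) (Fin n) ℝ) (hB : Bᵀ = B) (δ : ℝ)
    (h : ∀ (mu : ℝ) (v : Fin n → ℝ), v ≠ 0 → B *ᵥ v = mu • v → mu ≤ δ) (x : Fin n → ℝ) :
    x ⬝ᵥ (B *ᵥ x) ≤ δ * (x ⬝ᵥ x) := by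
  obtain ⟨V, D, h1, h2, h3⟩ := dk_spectral B hB
  have hD : ∀ i, D i ≤ δ := by
    intro i
    apply h (D i) (V *ᵥ Pi.single i 1)
    · intro h0
      have : Vᵀ *ᵥ (V *ᵥ Pi.single i 1) = 0 := by rw [h0, Matrix.mulVec_zero]
      rw [Matrix.mulVec_mulVec, h1, Matrix.one_mulVec] at this
      have := congrFun this i
      simp at this
    · rw [h3, Matrix.mulVec_mulVec, Matrix.mul_assoc, h1, Matrix.mul_one, ← Matrix.mulVec_mulVec,
        Matrix.diagonal_mulVec_single, ← Matrix.mulVec_smul]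
      congr 1
      ext k
      by_cases hk : k = i
      · subst hk; simp
      · simp [hk]
  rw [dk_orth_sq V x h2, Finset.mul_sum]
  conv_lhs => rw [h3]
  rw [dk_diag_quad]
  exact Finset.sum_le_sum fun i _ => mul_le_mul_of_nonneg_right (hD i) (sq_nonneg _)

theorem dk_cs {n : ℕ} (x y : Fin n → ℝ) : (x ⬝ᵥ y) ^ 2 ≤ (x ⬝ᵥ x) * (y ⬝ᵥ y) := by
  have := Finset.sum_mul_sq_le_sq_mul_sq Finset.univ x y
  simpa only [dotProduct, ← sq] using this

theorem dk_nn {n : ℕ} (x : Fin n → ℝ) : 0 ≤ x ⬝ᵥ x :=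
  Finset.sum_nonneg fun i _ => mul_self_nonneg _

theorem dk_dp_pos {n : ℕ} (x : Fin n → ℝ) (hx : x ≠ 0) : 0 < x ⬝ᵥ x := by
  rcases (dk_nn x).lt_or_eq with h | h
  · exact h
  · exact absurd (dotProduct_self_eq_zero.mp h.symm) hx

/-- Frobenius bound on matrix-vector products. -/
theorem dk_frob_mulVec {m n : ℕ} (M : Matrix (Fin m) (Fin n) ℝ) (x : Fin n → ℝ) :
    (M *ᵥ x) ⬝ᵥ (M *ᵥ x) ≤ (∑ i, ∑ j, (M i j) ^ 2) * (x ⬝ᵥ x) := by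
  rw [Finset.sum_mul]
  refine Finset.sum_le_sum fun i _ => ?_
  have := dk_cs (M i) x
  simp only [Matrix.mulVec]
  rw [← sq]
  refine this.trans (le_of_eq ?_)
  simp only [dotProduct, ← sq]

/-- Weyl-type bound: eigenvalues orthogonal to the top `d` are at most `δ`. -/
theorem dk_weyl {n d : ℕ} (A E : Matrix (Fin n) (Fin n) ℝ) (U Uh : Matrix (Fin n) (Fin d) ℝ)
    (lamh : Fin d → ℝ) (δ : ℝ) (hδ : 0 ≤ δ)
    (hUh : Uhᵀ * Uh = 1)
    (hAUh : A * Uh = Uh * Matrix.diagonal lamh)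
    (hker : ∀ x, Uᵀ *ᵥ x = 0 → A *ᵥ x = E *ᵥ x)
    (hE : ∀ x, (E *ᵥ x) ⬝ᵥ (E *ᵥ x) ≤ δ ^ 2 * (x ⬝ᵥ x))
    (mu : ℝ) (v : Fin n → ℝ) (hv : v ≠ 0) (hAv : A *ᵥ v = mu • v) (hvU : Uhᵀ *ᵥ v = 0)
    (htop : ∀ j, |mu| ≤ |lamh j|) : |mu| ≤ δ := by
  let f : (Fin d → ℝ) × ℝ →ₗ[ℝ] (Fin d → ℝ) :=
    (Matrix.mulVecLin (Uᵀ * Uh)).coprod ((LinearMap.id : ℝ →ₗ[ℝ] ℝ).smulRight (Uᵀ *ᵥ v))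
  have hk : LinearMap.ker f ≠ ⊥ := by
    apply LinearMap.ker_ne_bot_of_finrank_lt
    simp
  obtain ⟨⟨a, b⟩, hab, hne⟩ := (Submodule.ne_bot_iff _).mp hk
  have hf : Uᵀ *ᵥ (Uh *ᵥ a + b • v) = 0 := by
    have : f (a, b) = 0 := hab
    simp only [f, LinearMap.coprod_apply, Matrix.mulVecLin_apply, LinearMap.smulRight_apply,
      LinearMap.id_apply] at this
    rw [Matrix.mulVec_add, Matrix.mulVec_mulVec, Matrix.mulVec_smul]
    exact this
  have horth : ∀ c : Fin d → ℝ, (Uh *ᵥ c) ⬝ᵥ v = 0 := by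
    intro c
    rw [dotProduct_comm, Matrix.dotProduct_mulVec, ← Matrix.mulVec_transpose, hvU, zero_dotProduct]
  have hiso : ∀ c : Fin d → ℝ, (Uh *ᵥ c) ⬝ᵥ (Uh *ᵥ c) = c ⬝ᵥ c := by
    intro c
    rw [Matrix.dotProduct_mulVec, ← Matrix.mulVec_transpose, Matrix.mulVec_mulVec, hUh,
      Matrix.one_mulVec]
  have hsq : ∀ (c : Fin d → ℝ) (e : ℝ),
      (Uh *ᵥ c + e • v) ⬝ᵥ (Uh *ᵥ c + e • v) = c ⬝ᵥ c + e ^ 2 * (v ⬝ᵥ v) := by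
    intro c e
    have h1 := horth c
    have h2 : v ⬝ᵥ (Uh *ᵥ c) = 0 := by rw [dotProduct_comm]; exact h1
    simp only [add_dotProduct, dotProduct_add, smul_dotProduct, dotProduct_smul, hiso, h1, h2,
      smul_eq_mul]
    ring
  have hAx : A *ᵥ (Uh *ᵥ a + b • v) = Uh *ᵥ (fun j => lamh j * a j) + (b * mu) • v := by
    rw [Matrix.mulVec_add, Matrix.mulVec_mulVec, hAUh, ← Matrix.mulVec_mulVec, Matrix.mulVec_smul,
      hAv, smul_smul]
    congr 2
    ext j
    simp [Matrix.mulVec_diagonal]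
  have hx := hE (Uh *ᵥ a + b • v)
  rw [← hker _ hf, hAx, hsq, hsq] at hx
  have hvp := dk_dp_pos v hv
  have hpos : 0 < a ⬝ᵥ a + b ^ 2 * (v ⬝ᵥ v) := by
    by_cases hb : b = 0
    · have ha : a ≠ 0 := by
        rintro rfl
        exact hne (by simp [hb])
      have := dk_dp_pos a ha
      have : 0 ≤ b ^ 2 * (v ⬝ᵥ v) := by positivity
      linarith
    · have := dk_nn a
      have : 0 < b ^ 2 * (v ⬝ᵥ v) := by positivity
      linarith
  have hlow : mu ^ 2 * (a ⬝ᵥ a) ≤ (fun j => lamh j * a j) ⬝ᵥ (fun j => lamh j * a j) := by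
    simp only [dotProduct, Finset.mul_sum]
    refine Finset.sum_le_sum fun j _ => ?_
    have := sq_le_sq.mpr (htop j)
    nlinarith [mul_le_mul_of_nonneg_right this (mul_self_nonneg (a j))]
  have : mu ^ 2 ≤ δ ^ 2 := by
    by_contra hcon
    push Not at hcon
    nlinarith [mul_lt_mul_of_pos_right hcon hpos]
  have := sq_le_sq.mp this
  rwa [abs_of_nonneg hδ] at this

theorem dk_trace_sq {m n : ℕ} (M : Matrix (Fin m) (Fin n) ℝ) :
    ∑ i, ∑ j, (M i j) ^ 2 = (Mᵀ * M).trace := by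
  simp only [Matrix.trace, Matrix.diag_apply, Matrix.mul_apply, Matrix.transpose_apply]
  rw [Finset.sum_comm]
  simp only [sq]

/-- Procrustes: if `Uh, U` have orthonormal columns and the residual of the projection
is small then there is an orthogonal matrix aligning them. -/
theorem dk_procrustes {n d : ℕ} (U Uh : Matrix (Fin n) (Fin d) ℝ)
    (hU : Uᵀ * U = 1) (hUh : Uhᵀ * Uh = 1) (r : ℝ) (hr : r < 1)
    (hR : ∑ i, ∑ j, ((U - Uh * (Uhᵀ * U)) i j) ^ 2 ≤ r) :
    ∃ Q : Matrix (Fin d) (Fin d) ℝ, Qᵀ * Q = 1 ∧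
      ∑ i, ∑ j, ((Uh * Q - U) i j) ^ 2 ≤ 2 * r := by
  set W := Uhᵀ * U with hW
  set R := U - Uh * W with hRd
  have hRR : Rᵀ * R = 1 - Wᵀ * W := by
    have h1 : Wᵀ = Uᵀ * Uh := by rw [hW, Matrix.transpose_mul, Matrix.transpose_transpose]
    rw [hRd, Matrix.transpose_sub, Matrix.transpose_mul, Matrix.sub_mul, Matrix.mul_sub,
      Matrix.mul_sub, hU]
    have e1 : Uᵀ * (Uh * W) = Wᵀ * W := by rw [← Matrix.mul_assoc, ← h1]
    have e2 : Wᵀ * Uhᵀ * U = Wᵀ * W := by rw [Matrix.mul_assoc]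
    have e3 : Wᵀ * Uhᵀ * (Uh * W) = Wᵀ * W := by
      rw [Matrix.mul_assoc, ← Matrix.mul_assoc Uhᵀ, hUh, Matrix.one_mul]
    rw [e1, e2, e3]
    abel
  obtain ⟨V, D, hV1, hV2, hT⟩ := dk_spectral (Wᵀ * W)
    (by rw [Matrix.transpose_mul, Matrix.transpose_transpose])
  have hRV : (R * V)ᵀ * (R * V) = 1 - Matrix.diagonal D := by
    rw [Matrix.transpose_mul, Matrix.mul_assoc, ← Matrix.mul_assoc Rᵀ, hRR, hT, Matrix.sub_mul,
      Matrix.mul_sub, Matrix.one_mul, hV1]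
    congr 1
    rw [Matrix.mul_assoc (V * _), hV1, Matrix.mul_one, ← Matrix.mul_assoc, hV1, Matrix.one_mul]
  have hD1 : ∀ j, D j ≤ 1 := by
    intro j
    have := congrFun (congrFun hRV j) j
    simp only [Matrix.sub_apply, Matrix.one_apply_eq, Matrix.diagonal_apply_eq,
      Matrix.mul_apply (M := (R * V)ᵀ), Matrix.transpose_apply] at this
    have h2 : 0 ≤ ∑ i, (R * V) i j * (R * V) i j :=
      Finset.sum_nonneg fun i _ => mul_self_nonneg _
    linarith
  have htrT : (Wᵀ * W).trace = ∑ j, D j := by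
    rw [hT, Matrix.trace_mul_comm, ← Matrix.mul_assoc, hV1, Matrix.one_mul, Matrix.trace_diagonal]
  have htr : ∑ j, (1 - D j) ≤ r := by
    rw [dk_trace_sq, hRR, Matrix.trace_sub, htrT] at hR
    simpa [Matrix.trace_one, Finset.sum_sub_distrib] using hR
  have hD0 : ∀ j, 0 < D j := by
    intro j
    have := Finset.single_le_sum (f := fun j => 1 - D j)
      (fun j _ => by have := hD1 j; linarith) (Finset.mem_univ j)
    linarith
  let S : Fin d → ℝ := fun j => (Real.sqrt (D j))⁻¹
  have hS0 : ∀ j, 0 < Real.sqrt (D j) := fun j => Real.sqrt_pos.mpr (hD0 j)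
  let Q := W * V * Matrix.diagonal S * Vᵀ
  have hQW : Qᵀ * W = V * Matrix.diagonal (fun j => Real.sqrt (D j)) * Vᵀ := by
    simp only [Q, Matrix.transpose_mul, Matrix.transpose_transpose, Matrix.diagonal_transpose]
    rw [Matrix.mul_assoc, Matrix.mul_assoc (Matrix.diagonal S), Matrix.mul_assoc Vᵀ, hT,
      ← Matrix.mul_assoc Vᵀ, ← Matrix.mul_assoc Vᵀ, hV1, Matrix.one_mul,
      ← Matrix.mul_assoc (Matrix.diagonal S), Matrix.diagonal_mul_diagonal, ← Matrix.mul_assoc]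
    congr 3
    ext j
    simp only [S]
    have := hS0 j
    rw [inv_mul_eq_div, div_eq_iff this.ne', Real.mul_self_sqrt (hD0 j).le]
  have hQQ : Qᵀ * Q = 1 := by
    have : Qᵀ * Q = Qᵀ * W * (V * Matrix.diagonal S * Vᵀ) := by
      simp only [Q, Matrix.mul_assoc]
    rw [this, hQW]
    rw [Matrix.mul_assoc (V * _), Matrix.mul_assoc V (Matrix.diagonal S), ← Matrix.mul_assoc Vᵀ,
      hV1, Matrix.one_mul, Matrix.mul_assoc V, ← Matrix.mul_assoc (Matrix.diagonal _),
      Matrix.diagonal_mul_diagonal]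
    have : (fun i => Real.sqrt (D i) * S i) = fun _ => 1 := by
      ext j; simp only [S]; exact mul_inv_cancel₀ (hS0 j).ne'
    rw [this, Matrix.diagonal_one, Matrix.one_mul, hV2]
  refine ⟨Q, hQQ, ?_⟩
  have hexp : (Uh * Q - U)ᵀ * (Uh * Q - U) = 1 + 1 - Qᵀ * W - (Qᵀ * W)ᵀ := by
    rw [Matrix.transpose_sub, Matrix.transpose_mul, Matrix.sub_mul, Matrix.mul_sub,
      Matrix.mul_sub, hU]
    have e1 : Qᵀ * Uhᵀ * (Uh * Q) = 1 := by
      rw [Matrix.mul_assoc, ← Matrix.mul_assoc Uhᵀ, hUh, Matrix.one_mul, hQQ]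
    have e2 : Qᵀ * Uhᵀ * U = Qᵀ * W := by rw [Matrix.mul_assoc]
    have e3 : Uᵀ * (Uh * Q) = (Qᵀ * W)ᵀ := by
      rw [hW]; simp only [Matrix.transpose_mul, Matrix.transpose_transpose, Matrix.mul_assoc]
    rw [e1, e2, e3]
    abel
  rw [dk_trace_sq, hexp, Matrix.trace_sub, Matrix.trace_sub, Matrix.trace_transpose, hQW,
    Matrix.trace_mul_comm, ← Matrix.mul_assoc, hV1, Matrix.one_mul, Matrix.trace_diagonal,
    Matrix.trace_add, Matrix.trace_one]
  have hle : ∑ j, D j ≤ ∑ j, Real.sqrt (D j) := by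
    refine Finset.sum_le_sum fun j _ => ?_
    rw [Real.le_sqrt' (hD0 j)]
    nlinarith [hD0 j, hD1 j]
  simp only [Finset.sum_sub_distrib, Finset.sum_const, Finset.card_univ, nsmul_eq_mul,
    mul_one] at htr
  linarith

/-- The full deterministic bound. -/
theorem dk_det {n d : ℕ} (A E : Matrix (Fin n) (Fin n) ℝ) (U Uh : Matrix (Fin n) (Fin d) ℝ)
    (lam lamh : Fin d → ℝ) (δ g η : ℝ) (hδ : 0 ≤ δ) (hA : Aᵀ = A)
    (hU : Uᵀ * U = 1) (hUh : Uhᵀ * Uh = 1)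
    (hAUh : A * Uh = Uh * Matrix.diagonal lamh)
    (hAE : A = U * Matrix.diagonal lam * Uᵀ + E)
    (hE : ∀ x, (E *ᵥ x) ⬝ᵥ (E *ᵥ x) ≤ δ ^ 2 * (x ⬝ᵥ x))
    (htop : ∀ (mu : ℝ) (v : Fin n → ℝ), v ≠ 0 → A *ᵥ v = mu • v → Uhᵀ *ᵥ v = 0 →
      ∀ j, |mu| ≤ |lamh j|)
    (hg : 0 < g) (hgap : ∀ j, g ≤ lam j - δ)
    (hη : ∀ j, (E *ᵥ (Uᵀ j)) ⬝ᵥ (E *ᵥ (Uᵀ j)) ≤ η)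
    (hsmall : d * (η / g ^ 2) < 1) :
    ∃ Q : Matrix (Fin d) (Fin d) ℝ, Qᵀ * Q = 1 ∧
      ∑ i, ∑ j, ((Uh * Q - U) i j) ^ 2 ≤ 2 * (d * (η / g ^ 2)) := by
  refine dk_procrustes U Uh hU hUh _ hsmall ?_
  have hker : ∀ x, Uᵀ *ᵥ x = 0 → A *ᵥ x = E *ᵥ x := by
    intro x hx
    rw [hAE, Matrix.add_mulVec, ← Matrix.mulVec_mulVec, hx, Matrix.mulVec_zero, zero_add]
  let B := A - Uh * Matrix.diagonal lamh * Uhᵀ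
  have hBT : Bᵀ = B := by
    simp only [B, Matrix.transpose_sub, hA, Matrix.transpose_mul, Matrix.transpose_transpose,
      Matrix.diagonal_transpose, Matrix.mul_assoc]
  have hBUh : Uhᵀ * B = 0 := by
    have : B * Uh = 0 := by
      simp only [B, Matrix.sub_mul, hAUh]
      rw [Matrix.mul_assoc _ Uhᵀ, hUh, Matrix.mul_one, sub_self]
    rw [← Matrix.transpose_transpose (Uhᵀ * B), Matrix.transpose_mul, hBT,
      Matrix.transpose_transpose, this, Matrix.transpose_zero]
  have hBl : ∀ (mu : ℝ) (v : Fin n → ℝ), v ≠ 0 → B *ᵥ v = mu • v → mu ≤ δ := by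
    intro mu v hv hBv
    by_cases hmu : mu = 0
    · rw [hmu]; exact hδ
    have hvU : Uhᵀ *ᵥ v = 0 := by
      have h1 : Uhᵀ *ᵥ (B *ᵥ v) = 0 := by rw [Matrix.mulVec_mulVec, hBUh, Matrix.zero_mulVec]
      rw [hBv, Matrix.mulVec_smul] at h1
      exact (smul_eq_zero.mp h1).resolve_left hmu
    have hAv : A *ᵥ v = mu • v := by
      rw [← hBv]
      simp only [B, Matrix.sub_mulVec]
      rw [← Matrix.mulVec_mulVec, hvU, Matrix.mulVec_zero, sub_zero]
    exact (le_abs_self mu).trans (dk_weyl A E U Uh lamh δ hδ hUh hAUh hker hE mu v hv hAv hvU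
      (htop mu v hv hAv hvU))
  have hquad := dk_quad_le B hBT δ hBl
  rw [Finset.sum_comm]
  have hcol : ∀ j, ∑ i, ((U - Uh * (Uhᵀ * U)) i j) ^ 2 ≤ η / g ^ 2 := by
    intro j
    let u : Fin n → ℝ := Uᵀ j
    let r : Fin n → ℝ := u - Uh *ᵥ (Uhᵀ *ᵥ u)
    have hr : ∑ i, ((U - Uh * (Uhᵀ * U)) i j) ^ 2 = r ⬝ᵥ r := by
      simp only [dotProduct, ← sq]
      refine Finset.sum_congr rfl fun i _ => ?_
      congr 1
    rw [hr]
    have hUr : Uhᵀ *ᵥ r = 0 := by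
      simp only [r, Matrix.mulVec_sub]
      rw [Matrix.mulVec_mulVec, hUh, Matrix.one_mulVec, sub_self]
    have horth : ∀ c : Fin d → ℝ, r ⬝ᵥ (Uh *ᵥ c) = 0 := by
      intro c
      rw [Matrix.dotProduct_mulVec, ← Matrix.mulVec_transpose, hUr, zero_dotProduct]
    have hu : u = r + Uh *ᵥ (Uhᵀ *ᵥ u) := by simp [r]
    have hru : r ⬝ᵥ u = r ⬝ᵥ r := by
      conv_lhs => rw [hu]
      rw [dotProduct_add, horth, add_zero]
    have hUu : Uᵀ *ᵥ u = Pi.single j 1 := by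
      have h1 : u = U *ᵥ Pi.single j 1 := by
        ext i; simp [u]
      rw [h1, Matrix.mulVec_mulVec, hU, Matrix.one_mulVec]
    have hAu : A *ᵥ u = lam j • u + E *ᵥ u := by
      rw [hAE, Matrix.add_mulVec]
      congr 1
      rw [← Matrix.mulVec_mulVec, hUu, ← Matrix.mulVec_mulVec, Matrix.diagonal_mulVec_single]
      ext i
      simp [u, mul_comm]
    have h1 : r ⬝ᵥ (A *ᵥ u) = lam j * (r ⬝ᵥ r) + r ⬝ᵥ (E *ᵥ u) := by
      rw [hAu, dotProduct_add, dotProduct_smul, hru, smul_eq_mul]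
    have h2 : r ⬝ᵥ (A *ᵥ u) = r ⬝ᵥ (A *ᵥ r) := by
      conv_lhs => rw [hu]
      rw [Matrix.mulVec_add, dotProduct_add, Matrix.mulVec_mulVec (M := A) (N := Uh), hAUh,
        ← Matrix.mulVec_mulVec, horth, add_zero]
    have h3 : B *ᵥ r = A *ᵥ r := by
      simp only [B, Matrix.sub_mulVec]
      rw [← Matrix.mulVec_mulVec, hUr, Matrix.mulVec_zero, sub_zero]
    have h4 := hquad r
    rw [h3, ← h2, h1] at h4
    have hcs := dk_cs r (E *ᵥ u)
    have hηj : (E *ᵥ u) ⬝ᵥ (E *ᵥ u) ≤ η := hη j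
    have hη0 : 0 ≤ η := (dk_nn _).trans hηj
    have hrr := dk_nn r
    rw [le_div_iff₀ (by positivity)]
    have hgj := hgap j
    set a := r ⬝ᵥ r
    set e := r ⬝ᵥ (E *ᵥ u)
    set w := (E *ᵥ u) ⬝ᵥ (E *ᵥ u)
    rcases hrr.lt_or_eq with h0 | h0
    · have h5 : g * a ≤ -e := by nlinarith
      have h6 : (g * a) ^ 2 ≤ e ^ 2 := by
        rw [← neg_sq e]; exact pow_le_pow_left₀ (by positivity) h5 2
      have h7 : a * (a * g ^ 2) ≤ a * η := by nlinarith
      exact le_of_mul_le_mul_left h7 h0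
    · rw [← h0]; simpa using hη0
  calc _ ≤ ∑ j : Fin d, η / g ^ 2 := Finset.sum_le_sum fun j _ => hcol j
    _ = _ := by simp

/-! ### Probabilistic tools -/

open ProbabilityTheory in
theorem dk_hoeff {Ω : Type*} [MeasurableSpace Ω] (μ : Measure Ω) [IsProbabilityMeasure μ]
    {ι : Type*} [Fintype ι] (Y : ι → Ω → ℝ) (hind : iIndepFun Y μ)
    (hm : ∀ k, AEMeasurable (Y k) μ) (hb : ∀ k, ∀ᵐ ω ∂μ, |Y k ω| ≤ 2)
    (h0 : ∀ k, ∫ ω, Y k ω ∂μ = 0) (n : ℕ) (hn : Fintype.card ι ≤ n) (s : ℝ) (hs : 0 < s) :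
    μ {ω | s ≤ |∑ k, Y k ω|} ≤ ENNReal.ofReal (2 * Real.exp (-s ^ 2 / (8 * n))) := by
  rcases Nat.eq_zero_or_pos (Fintype.card ι) with hc | hc
  · have : IsEmpty ι := Fintype.card_eq_zero_iff.mp hc
    have h : {ω : Ω | s ≤ |∑ k, Y k ω|} = ∅ := by
      ext ω; simp [hs]
    rw [h]; simp
  have hsub : ∀ k, HasSubgaussianMGF (Y k) ((‖(2:ℝ) - (-2)‖₊ / 2) ^ 2) μ := fun k =>
    hasSubgaussianMGF_of_mem_Icc_of_integral_eq_zero (hm k)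
      ((hb k).mono fun ω h => abs_le.mp h) (h0 k)
  have hcst : ((‖(2:ℝ) - (-2)‖₊ / 2) ^ 2 : ℝ≥0) = 4 := by
    apply NNReal.coe_injective
    push_cast
    norm_num
  rw [hcst] at hsub
  have hexp : Real.exp (-s ^ 2 / (2 * ((∑ _k : ι, (4:ℝ≥0) : ℝ≥0) : ℝ)))
      ≤ Real.exp (-s ^ 2 / (8 * n)) := by
    apply Real.exp_le_exp.mpr
    have hc' : (0:ℝ) < Fintype.card ι := by exact_mod_cast hc
    have hn' : (Fintype.card ι : ℝ) ≤ n := by exact_mod_cast hn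
    have : ((∑ _k : ι, (4:ℝ≥0) : ℝ≥0) : ℝ) = Fintype.card ι * 4 := by
      simp
    rw [this, neg_div, neg_div, neg_le_neg_iff]
    apply div_le_div_of_nonneg_left (sq_nonneg s) (by positivity)
    linarith
  have h1 := (HasSubgaussianMGF.measure_sum_ge_le_of_iIndepFun hind (s := Finset.univ)
    (c := fun _ => 4) (fun i _ => hsub i) hs.le).trans hexp
  have hind2 : iIndepFun (fun k => -Y k) μ :=
    hind.comp (fun _ x => -x) (fun _ => measurable_neg)
  have h2 := (HasSubgaussianMGF.measure_sum_ge_le_of_iIndepFun hind2 (s := Finset.univ)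
    (c := fun _ => 4) (fun i _ => (hsub i).neg) hs.le).trans hexp
  have hsubset : {ω | s ≤ |∑ k, Y k ω|} ⊆
      {ω | s ≤ ∑ k, Y k ω} ∪ {ω | s ≤ ∑ k, (-Y k) ω} := by
    intro ω hω
    simp only [Set.mem_ofPred_eq, Set.mem_union, Pi.neg_apply, Finset.sum_neg_distrib] at hω ⊢
    exact le_abs.mp hω
  refine (measure_mono hsubset).trans ((measure_union_le _ _).trans ?_)
  rw [two_mul, ENNReal.ofReal_add (Real.exp_pos _).le (Real.exp_pos _).le]
  gcongr
  · rw [← ofReal_measureReal]; exact ENNReal.ofReal_le_ofReal h1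
  · rw [← ofReal_measureReal]; exact ENNReal.ofReal_le_ofReal h2

open ProbabilityTheory in
theorem dk_curry_indep {Ω : Type*} [MeasurableSpace Ω] (μ : Measure Ω)
    {J K : Type} {X : J → K → Ω → ℝ} (mX : ∀ i j, Measurable (X i j))
    (h : iIndepFun (fun (p : J × K) ω => X p.1 p.2 ω) μ) :
    iIndepFun (fun i ω (j : K) => X i j ω) μ := by
  have := h.isProbabilityMeasure
  have : ∀ i j, IsProbabilityMeasure (μ.map (X i j)) :=
    fun i j ↦ Measure.isProbabilityMeasure_map (mX i j).aemeasurable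
  have h2 : ∀ i, iIndepFun (X i) μ := fun i =>
    h.precomp (g := fun j : K => (i, j)) (fun a b hab => (Prod.mk.inj hab).2)
  have : ∀ i, IsProbabilityMeasure (μ.map (fun ω ↦ (X i · ω))) :=
    fun i ↦ Measure.isProbabilityMeasure_map (Measurable.aemeasurable (by fun_prop))
  rw [iIndepFun_iff_map_fun_eq_infinitePi_map (by fun_prop)]
  have e : (fun ω (i : J) (j : K) => X i j ω) =
      (MeasurableEquiv.curry J K ℝ) ∘ (fun ω (p : J × K) ↦ X p.1 p.2 ω) := by
    ext; rfl
  rw [e, ← Measure.map_map (by fun_prop) (by fun_prop),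
    (iIndepFun_iff_map_fun_eq_infinitePi_map (by fun_prop)).1 h,
    Measure.infinitePi_map_curry (fun i j ↦ μ.map (X i j))]
  congrm Measure.infinitePi fun i ↦ ?_
  rw [(iIndepFun_iff_map_fun_eq_infinitePi_map (by fun_prop)).1 (h2 i)]

/-- The support has full measure. -/
theorem dk_support {d : ℕ} (F : Measure (Fin d → ℝ)) : ∀ᵐ x ∂F, x ∈ msupport F := by
  rw [ae_iff]
  apply measure_null_of_locally_null
  intro x hx
  simp only [msupport, Set.mem_ofPred_eq, not_forall, not_lt, nonpos_iff_eq_zero] at hx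
  obtain ⟨U, hU, hxU, h0⟩ := hx
  exact ⟨U, mem_nhdsWithin_of_mem_nhds (hU.mem_nhds hxU), h0⟩

theorem dk_support_pi {d n : ℕ} (F : Measure (Fin d → ℝ)) [IsProbabilityMeasure F] :
    ∀ᵐ X ∂(Measure.pi fun _ : Fin n => F), ∀ i, X i ∈ msupport F := by
  rw [ae_all_iff]
  intro i
  exact (Measure.tendsto_eval_ae_ae (μ := fun _ : Fin n => F) (i := i)).eventually (dk_support F)

instance dk_unit_prob : IsProbabilityMeasure (volume.restrict (Set.Icc (0:ℝ) 1)) :=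
  ⟨by simp⟩

instance dk_pair_prob (n : ℕ) : IsProbabilityMeasure (pairUniform n) := by
  unfold pairUniform; infer_instance

/-- Centered Bernoulli. -/
def dkxi (p t : ℝ) : ℝ := (if t < p then 1 else 0) - p

theorem dkxi_meas (p : ℝ) : Measurable (dkxi p) :=
  (Measurable.ite measurableSet_Iio measurable_const measurable_const).sub_const _

theorem dkxi_abs (p t : ℝ) (h0 : 0 ≤ p) (h1 : p ≤ 1) : |dkxi p t| ≤ 1 := by
  unfold dkxi; rw [abs_le]; split_ifs <;> constructor <;> linarith

theorem dkxi_int (p : ℝ) (h0 : 0 ≤ p) (h1 : p ≤ 1) :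
    ∫ t, dkxi p t ∂(volume.restrict (Set.Icc (0:ℝ) 1)) = 0 := by
  have e : ∀ t, (if t < p then (1:ℝ) else 0) = (Set.Iio p).indicator (fun _ => 1) t := by
    intro t; simp [Set.indicator]
  unfold dkxi
  rw [integral_sub, integral_const]
  · simp_rw [e]
    rw [integral_indicator_const _ measurableSet_Iio]
    have : Set.Iio p ∩ Set.Icc (0:ℝ) 1 = Set.Ico 0 p := by
      ext t; simp only [Set.mem_inter_iff, Set.mem_Iio, Set.mem_Icc, Set.mem_Ico]
      constructor
      · rintro ⟨a, b, c⟩; exact ⟨b, a⟩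
      · rintro ⟨a, b⟩; exact ⟨b, a, by linarith⟩
    rw [measureReal_restrict_apply measurableSet_Iio, this]
    simp [h0]
  · simp_rw [e]
    exact (integrable_const _).indicator measurableSet_Iio
  · exact integrable_const _

/-- Ordered pair. -/
def dkpr {n : ℕ} (i j : Fin n) : Fin n × Fin n := (min i j, max i j)

theorem dkpr_eq {n : ℕ} (a b c e : Fin n) (h : dkpr a b = dkpr c e) :
    (a = c ∧ b = e) ∨ (a = e ∧ b = c) := by
  simp only [dkpr, Prod.mk.injEq] at h
  obtain ⟨h1, h2⟩ := h
  rcases le_total a b with hab | hab <;> rcases le_total c e with hce | hce <;>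
    simp_all

theorem dk_E_eq {d n : ℕ} (X : Fin n → Fin d → ℝ) (u : Fin n × Fin n → ℝ) (i j : Fin n)
    (hij : i ≠ j) :
    adjOf 1 X u i j - dotd (X i) (X j) = dkxi (dotd (X i) (X j)) (u (dkpr i j)) := by
  simp only [adjOf, hij, dkxi, dkpr, if_false, one_mul]
  congr

theorem dk_eval_int {n : ℕ} (q : Fin n × Fin n) (f : ℝ → ℝ) (hf : Measurable f) :
    ∫ u, f (u q) ∂(pairUniform n) = ∫ t, f t ∂(volume.restrict (Set.Icc (0:ℝ) 1)) := by
  have h := (measurePreserving_eval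
    (fun _ : Fin n × Fin n => volume.restrict (Set.Icc (0:ℝ) 1)) q)
  have := integral_map (μ := pairUniform n) h.measurable.aemeasurable (f := f)
    hf.aestronglyMeasurable
  unfold pairUniform at *
  rw [h.map_eq] at this
  exact this.symm

open ProbabilityTheory in
theorem dk_indep {n : ℕ} (p : Fin n × Fin n → ℝ) :
    iIndepFun (fun q (u : Fin n × Fin n → ℝ) => dkxi (p q) (u q)) (pairUniform n) :=
  iIndepFun_pi (X := fun q => dkxi (p q)) (fun q => (dkxi_meas _).aemeasurable)

theorem dk_dotd_comm {d : ℕ} (x y : Fin d → ℝ) : dotd x y = dotd y x := by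
  unfold dotd; exact Finset.sum_congr rfl fun _ _ => mul_comm _ _

theorem dk_coord {d : ℕ} (x : Fin d → ℝ) (h : dotd x x ≤ 1) (a : Fin d) : |x a| ≤ 1 := by
  have : x a * x a ≤ dotd x x :=
    Finset.single_le_sum (f := fun k => x k * x k) (fun k _ => mul_self_nonneg _)
      (Finset.mem_univ a)
  rw [← sq_le_one_iff_abs_le_one]; nlinarith

open ProbabilityTheory in
/-- Tail bound for rows of `E X`. -/
theorem dk_tail2 {d n : ℕ} (X : Fin n → Fin d → ℝ)
    (hX : ∀ i j, 0 ≤ dotd (X i) (X j) ∧ dotd (X i) (X j) ≤ 1) (i : Fin n) (a : Fin d)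
    (s : ℝ) (hs : 0 < s) :
    pairUniform n {u | s ≤ |∑ j ∈ Finset.univ.erase i,
      (adjOf 1 X u i j - dotd (X i) (X j)) * X j a|} ≤
      ENNReal.ofReal (2 * Real.exp (-s ^ 2 / (8 * n))) := by
  let S : Finset (Fin n) := Finset.univ.erase i
  let Y : S → (Fin n × Fin n → ℝ) → ℝ := fun j u =>
    dkxi (dotd (X i) (X j)) (u (dkpr i j)) * X j a
  have hcard : Fintype.card S ≤ n := by
    rw [Fintype.card_coe]; exact (Finset.card_le_univ S).trans (by simp)
  have hY : ∀ u, ∑ j ∈ Finset.univ.erase i, (adjOf 1 X u i j - dotd (X i) (X j)) * X j a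
      = ∑ j : S, Y j u := by
    intro u
    rw [← Finset.sum_coe_sort]
    refine Finset.sum_congr rfl fun j _ => ?_
    rw [dk_E_eq X u i j (fun h => (Finset.mem_erase.mp j.2).1 h.symm)]
  simp_rw [hY]
  refine dk_hoeff _ Y ?_ ?_ ?_ ?_ n hcard s hs
  · have h1 := dk_indep (fun q => dotd (X q.1) (X q.2))
    have h2 := h1.precomp (g := fun j : S => dkpr i j) (by
      intro j k hjk
      rcases dkpr_eq _ _ _ _ hjk with h | h
      · exact Subtype.ext h.2
      · exact absurd h.2 (Finset.mem_erase.mp j.2).1)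
    have h3 := h2.comp (fun j x => x * X j a) (fun j => measurable_id.mul_const _)
    convert h3 using 2 with j
    ext u
    simp only [Y, Function.comp]
    congr 2
    rcases le_total i j with h | h
    · simp [dkpr, h]
    · simp only [dkpr, min_eq_right h, max_eq_left h]; exact dk_dotd_comm _ _
  · intro j
    exact (((dkxi_meas _).comp (measurable_pi_apply _)).mul_const _).aemeasurable
  · intro j
    refine Eventually.of_forall fun u => ?_
    simp only [Y, abs_mul]
    have h1 := dkxi_abs _ (u (dkpr i j)) (hX i j).1 (hX i j).2
    have h2 := dk_coord (X j) (hX j j).2 a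
    nlinarith [abs_nonneg (X j a), abs_nonneg (dkxi (dotd (X i) (X j)) (u (dkpr i j)))]
  · intro j
    simp only [Y]
    rw [integral_mul_const, dk_eval_int _ _ (dkxi_meas _), dkxi_int _ (hX i j).1 (hX i j).2,
      zero_mul]

open ProbabilityTheory in
/-- Tail bound for off-diagonal entries of `E²`. -/
theorem dk_tail1 {d n : ℕ} (X : Fin n → Fin d → ℝ)
    (hX : ∀ i j, 0 ≤ dotd (X i) (X j) ∧ dotd (X i) (X j) ≤ 1) (i j : Fin n) (hij : i ≠ j)
    (s : ℝ) (hs : 0 < s) :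
    pairUniform n {u | s ≤ |∑ k ∈ (Finset.univ.erase i).erase j,
      (adjOf 1 X u i k - dotd (X i) (X k)) * (adjOf 1 X u k j - dotd (X k) (X j))|} ≤
      ENNReal.ofReal (2 * Real.exp (-s ^ 2 / (8 * n))) := by
  let S : Finset (Fin n) := (Finset.univ.erase i).erase j
  have hS : ∀ k : S, (k : Fin n) ≠ j ∧ (k : Fin n) ≠ i := fun k => by
    have := k.2
    simp only [S, Finset.mem_erase, Finset.mem_univ, and_true] at this
    exact this
  let pr : S × Bool → Fin n × Fin n := fun q => if q.2 then dkpr i q.1 else dkpr q.1 j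
  have hpr : Function.Injective pr := by
    rintro ⟨k, b⟩ ⟨l, c⟩ h
    have hk := hS k
    have hl := hS l
    cases b <;> cases c <;> simp only [pr, if_true, Bool.false_eq_true, if_false] at h <;>
      rcases dkpr_eq _ _ _ _ h with h | h
    · rw [Subtype.ext h.1]
    · exact absurd h.1 hk.1
    · exact absurd h.1 hk.2
    · exact absurd h.2.symm hij
    · exact absurd h.1.symm hl.2
    · exact absurd h.1 hij
    · rw [Subtype.ext h.2]
    · exact absurd h.1.symm hl.2
  let Z : S → Bool → (Fin n × Fin n → ℝ) → ℝ := fun k b u =>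
    dkxi (dotd (X (pr (k, b)).1) (X (pr (k, b)).2)) (u (pr (k, b)))
  have hZm : ∀ k b, Measurable (Z k b) := fun k b =>
    (dkxi_meas _).comp (measurable_pi_apply _)
  have hZi : iIndepFun (fun (q : S × Bool) u => Z q.1 q.2 u) (pairUniform n) :=
    (dk_indep (fun q => dotd (X q.1) (X q.2))).precomp hpr
  have hZc := dk_curry_indep _ hZm hZi
  let Y : S → (Fin n × Fin n → ℝ) → ℝ := fun k u => Z k true u * Z k false u
  have hcard : Fintype.card S ≤ n := by
    rw [Fintype.card_coe]; exact (Finset.card_le_univ S).trans (by simp)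
  have hpdot : ∀ a b : Fin n, dotd (X (dkpr a b).1) (X (dkpr a b).2) = dotd (X a) (X b) := by
    intro a b
    rcases le_total a b with h | h
    · simp [dkpr, h]
    · simp only [dkpr, min_eq_right h, max_eq_left h]; exact dk_dotd_comm _ _
  have hY : ∀ u, ∑ k ∈ (Finset.univ.erase i).erase j,
      (adjOf 1 X u i k - dotd (X i) (X k)) * (adjOf 1 X u k j - dotd (X k) (X j))
      = ∑ k : S, Y k u := by
    intro u
    rw [← Finset.sum_coe_sort]
    refine Finset.sum_congr rfl fun k _ => ?_
    rw [dk_E_eq X u i k (fun h => (hS k).2 h.symm), dk_E_eq X u k j (hS k).1]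
    simp only [Y, Z, pr, if_true, Bool.false_eq_true, if_false, hpdot]
  have hZb : ∀ k b u, |Z k b u| ≤ 1 := fun k b u => dkxi_abs _ _ (hX _ _).1 (hX _ _).2
  have hZ0 : ∀ k b, ∫ u, Z k b u ∂(pairUniform n) = 0 := fun k b => by
    simp only [Z]
    rw [dk_eval_int _ _ (dkxi_meas _), dkxi_int _ (hX _ _).1 (hX _ _).2]
  simp_rw [hY]
  refine dk_hoeff _ Y ?_ ?_ ?_ ?_ n hcard s hs
  · exact hZc.comp (fun _ x => x true * x false) (fun _ =>
      (measurable_pi_apply _).mul (measurable_pi_apply _))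
  · intro k
    exact ((hZm k true).mul (hZm k false)).aemeasurable
  · intro k
    refine Eventually.of_forall fun u => ?_
    simp only [Y, abs_mul]
    nlinarith [hZb k true u, hZb k false u, abs_nonneg (Z k true u), abs_nonneg (Z k false u)]
  · intro k
    have hi : IndepFun (Z k true) (Z k false) (pairUniform n) :=
      hZi.indepFun (i := (k, true)) (j := (k, false)) (by simp)
    have := hi.integral_fun_mul_eq_mul_integral (hZm k true).aestronglyMeasurable
      (hZm k false).aestronglyMeasurable
    simp only [Y]
    rw [this, hZ0, zero_mul]

open ProbabilityTheory in
/-- Tail bound for the second moment matrix. -/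
theorem dk_tail3 {d n : ℕ} (F : Measure (Fin d → ℝ)) [IsProbabilityMeasure F]
    (hF : InnerProductDistribution d F) (a b : Fin d) (s : ℝ) (hs : 0 < s) :
    (Measure.pi fun _ : Fin n => F) {X | s ≤ |∑ i, (X i a * X i b - secondMoment F a b)|} ≤
      ENNReal.ofReal (2 * Real.exp (-s ^ 2 / (8 * n))) := by
  have hm : Measurable fun x : Fin d → ℝ => x a * x b :=
    (measurable_pi_apply _).mul (measurable_pi_apply _)
  have hae : ∀ᵐ x ∂F, ‖x a * x b‖ ≤ 1 := (dk_support F).mono fun x hx => by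
    have h1 := dk_coord x (hF.2 x hx x hx).2 a
    have h2 := dk_coord x (hF.2 x hx x hx).2 b
    rw [Real.norm_eq_abs, abs_mul]
    nlinarith [abs_nonneg (x a), abs_nonneg (x b)]
  have hintg : Integrable (fun x : Fin d → ℝ => x a * x b) F :=
    Integrable.of_bound hm.aestronglyMeasurable 1 hae
  have hsm : |secondMoment F a b| ≤ 1 := by
    have := norm_integral_le_of_norm_le_const hae
    simpa [secondMoment] using this
  refine dk_hoeff _ (fun (i : Fin n) (X : Fin n → Fin d → ℝ) =>
    X i a * X i b - secondMoment F a b) ?_ ?_ ?_ ?_ n (by simp) s hs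
  · exact iIndepFun_pi (X := fun (_ : Fin n) (x : Fin d → ℝ) => x a * x b - secondMoment F a b)
      (fun _ => (hm.sub_const _).aemeasurable)
  · intro i
    exact ((hm.sub_const _).comp (measurable_pi_apply i)).aemeasurable
  · intro i
    refine ((Measure.tendsto_eval_ae_ae (μ := fun _ : Fin n => F) (i := i)).eventually hae).mono
      fun X hX => ?_
    simp only [Function.eval, Real.norm_eq_abs] at hX
    have := abs_sub (X i a * X i b) (secondMoment F a b)
    linarith
  · intro i
    have h := measurePreserving_eval (fun _ : Fin n => F) i
    have h2 := integral_map (μ := Measure.pi fun _ : Fin n => F) h.measurable.aemeasurable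
      (f := fun x : Fin d → ℝ => x a * x b - secondMoment F a b)
      (hm.sub_const _).aestronglyMeasurable
    rw [h.map_eq, integral_sub hintg (integrable_const _), integral_const] at h2
    simp only [Function.eval] at h2
    rw [← h2]
    simp [secondMoment]

/-! ### Deterministic bound on the good event -/

theorem dk_E2_entry {n : ℕ} (E : Matrix (Fin n) (Fin n) ℝ) (s : ℝ) (hs : 0 ≤ s)
    (hE1 : ∀ i j, |E i j| ≤ 1)
    (h1 : ∀ i j, i ≠ j → |∑ k ∈ (Finset.univ.erase i).erase j, E i k * E k j| ≤ s) :
    ∑ i, ∑ j, ((E * E) i j) ^ 2 ≤ (n * (s + 2)) ^ 2 + (n : ℝ) ^ 3 := by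
  have hm : ∀ i j k l, |E i j * E k l| ≤ 1 := fun i j k l => by
    rw [abs_mul]
    nlinarith [hE1 i j, hE1 k l, abs_nonneg (E i j), abs_nonneg (E k l)]
  have hoff : ∀ i j, i ≠ j → ((E * E) i j) ^ 2 ≤ (s + 2) ^ 2 := by
    intro i j hij
    have e : (E * E) i j = E i i * E i j + (E i j * E j j +
        ∑ k ∈ (Finset.univ.erase i).erase j, E i k * E k j) := by
      rw [Matrix.mul_apply, ← Finset.add_sum_erase _ _ (Finset.mem_univ i),
        ← Finset.add_sum_erase (Finset.univ.erase i) _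
          (Finset.mem_erase.mpr ⟨hij.symm, Finset.mem_univ j⟩)]
    rw [← sq_abs]
    have : |(E * E) i j| ≤ s + 2 := by
      rw [e]
      have a1 := abs_add_le (E i i * E i j) (E i j * E j j +
        ∑ k ∈ (Finset.univ.erase i).erase j, E i k * E k j)
      have a2 := abs_add_le (E i j * E j j) (∑ k ∈ (Finset.univ.erase i).erase j, E i k * E k j)
      linarith [hm i i i j, hm i j j j, h1 i j hij]
    exact pow_le_pow_left₀ (abs_nonneg _) this 2
  have hdiag : ∀ i, ((E * E) i i) ^ 2 ≤ (n : ℝ) ^ 2 := by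
    intro i
    rw [← sq_abs]
    refine pow_le_pow_left₀ (abs_nonneg _) ?_ 2
    rw [Matrix.mul_apply]
    refine (Finset.abs_sum_le_sum_abs _ _).trans ?_
    refine (Finset.sum_le_sum fun k _ => hm i k k i).trans ?_
    simp
  have hrow : ∀ i, ∑ j, ((E * E) i j) ^ 2 ≤ n * (s + 2) ^ 2 + (n : ℝ) ^ 2 := by
    intro i
    have : ∀ j, ((E * E) i j) ^ 2 ≤ (s + 2) ^ 2 + if j = i then (n : ℝ) ^ 2 else 0 := by
      intro j
      by_cases h : j = i
      · subst h
        simp only [if_true]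
        nlinarith [hdiag j, sq_nonneg (s + 2)]
      · simp only [h, if_false, add_zero]
        exact hoff i j (Ne.symm h)
    refine (Finset.sum_le_sum fun j _ => this j).trans ?_
    rw [Finset.sum_add_distrib]
    simp
  refine (Finset.sum_le_sum fun i _ => hrow i).trans ?_
  simp only [Finset.sum_const, Finset.card_univ, Fintype.card_fin, nsmul_eq_mul]
  apply le_of_eq; ring

theorem dk_opnorm {n : ℕ} (E : Matrix (Fin n) (Fin n) ℝ) (hE : Eᵀ = E) (δ : ℝ)
    (h : ∑ i, ∑ j, ((E * E) i j) ^ 2 ≤ δ ^ 4) (x : Fin n → ℝ) :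
    (E *ᵥ x) ⬝ᵥ (E *ᵥ x) ≤ δ ^ 2 * (x ⬝ᵥ x) := by
  have e : (E *ᵥ x) ⬝ᵥ (E *ᵥ x) = x ⬝ᵥ ((E * E) *ᵥ x) := by
    rw [← Matrix.mulVec_mulVec, Matrix.dotProduct_mulVec x E, ← Matrix.mulVec_transpose, hE]
  have h1 := dk_cs x ((E * E) *ᵥ x)
  have h2 := dk_frob_mulVec (E * E) x
  rw [← e] at h1
  have hx := dk_nn x
  have h3 : ((E *ᵥ x) ⬝ᵥ (E *ᵥ x)) ^ 2 ≤ (δ ^ 2 * (x ⬝ᵥ x)) ^ 2 := by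
    have h4 := mul_le_mul_of_nonneg_left (h2.trans (mul_le_mul_of_nonneg_right h hx)) hx
    nlinarith
  exact (abs_le_of_sq_le_sq' h3 (by positivity)).2

theorem dk_EX {n d : ℕ} (E : Matrix (Fin n) (Fin n) ℝ) (X : Matrix (Fin n) (Fin d) ℝ) (s : ℝ)
    (hE1 : ∀ i j, |E i j| ≤ 1) (hX1 : ∀ i a, |X i a| ≤ 1)
    (h2 : ∀ i a, |∑ j ∈ Finset.univ.erase i, E i j * X j a| ≤ s) :
    ∑ i, ∑ a, ((E * X) i a) ^ 2 ≤ n * d * (s + 1) ^ 2 := by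
  have : ∀ i a, ((E * X) i a) ^ 2 ≤ (s + 1) ^ 2 := by
    intro i a
    rw [← sq_abs]
    refine pow_le_pow_left₀ (abs_nonneg _) ?_ 2
    rw [Matrix.mul_apply, ← Finset.add_sum_erase _ _ (Finset.mem_univ i)]
    refine (abs_add_le _ _).trans ?_
    have : |E i i * X i a| ≤ 1 := by
      rw [abs_mul]
      nlinarith [hE1 i i, hX1 i a, abs_nonneg (E i i), abs_nonneg (X i a)]
    linarith [h2 i a]
  refine (Finset.sum_le_sum fun i _ => Finset.sum_le_sum fun a _ => this i a).trans ?_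
  simp only [Finset.sum_const, Finset.card_univ, Fintype.card_fin, nsmul_eq_mul]
  apply le_of_eq; ring

theorem dk_good {n d : ℕ} (A : Fin n → Fin n → ℝ) (X : Fin n → Fin d → ℝ) (s c : ℝ)
    (hs : 0 ≤ s) (hc : 0 < c) (hn : 0 < n)
    (hA : ∀ i j, A i j = A j i)
    (hE1 : ∀ i j, |A i j - dotd (X i) (X j)| ≤ 1)
    (hX1 : ∀ i a, |X i a| ≤ 1)
    (h1 : ∀ i j, i ≠ j → |∑ k ∈ (Finset.univ.erase i).erase j,
      (A i k - dotd (X i) (X k)) * (A k j - dotd (X k) (X j))| ≤ s)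
    (h2 : ∀ i a, |∑ j ∈ Finset.univ.erase i, (A i j - dotd (X i) (X j)) * X j a| ≤ s)
    (h3 : ∀ w : Fin d → ℝ, c * n * (w ⬝ᵥ w) ≤ (Matrix.of X *ᵥ w) ⬝ᵥ (Matrix.of X *ᵥ w))
    (hn1 : (n * (s + 2)) ^ 2 + (n : ℝ) ^ 3 ≤ (c * n / 2) ^ 4)
    (hn2 : d * ((n * d * (s + 1) ^ 2 / (c * n)) / (c * n / 2) ^ 2) < 1)
    (U Uh : Fin n → Fin d → ℝ) (lam lamh : Fin d → ℝ)
    (hU : IsSpecDecomp (fun i i' => dotd (X i) (X i')) U lam) (hlam : ∀ j, 0 < lam j)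
    (hUh : IsTopSpec A Uh lamh) :
    ∃ Q : Matrix (Fin d) (Fin d) ℝ, Qᵀ * Q = 1 ∧
      ∑ i, ∑ j, ((Matrix.of Uh * Q - Matrix.of U) i j) ^ 2 ≤
        2 * (d * ((n * d * (s + 1) ^ 2 / (c * n)) / (c * n / 2) ^ 2)) := by
  obtain ⟨hU1, hU2, hU3⟩ := hU
  obtain ⟨hV1, hV2, hV3⟩ := hUh
  have hn0 : (0 : ℝ) < n := by exact_mod_cast hn
  let E : Matrix (Fin n) (Fin n) ℝ := Matrix.of fun i j => A i j - dotd (X i) (X j)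
  have hET : Eᵀ = E := by
    ext i j
    simp only [E, Matrix.transpose_apply, Matrix.of_apply, hA i j, dk_dotd_comm (X i) (X j)]
  have hUm : (Matrix.of U)ᵀ * Matrix.of U = 1 := by
    ext j j'
    simp only [Matrix.mul_apply, Matrix.transpose_apply, Matrix.of_apply, hU1, Matrix.one_apply]
  have hUhm : (Matrix.of Uh)ᵀ * Matrix.of Uh = 1 := by
    ext j j'
    simp only [Matrix.mul_apply, Matrix.transpose_apply, Matrix.of_apply, hV1, Matrix.one_apply]
  have hop := dk_opnorm E hET (c * n / 2) ((dk_E2_entry E s hs hE1 h1).trans hn1)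
  have hEX := dk_EX E (Matrix.of X) s hE1 hX1 h2
  have hXX : ∀ v : Fin n → ℝ, Matrix.of X *ᵥ ((Matrix.of X)ᵀ *ᵥ v) =
      (Matrix.of fun i i' => dotd (X i) (X i')) *ᵥ v := by
    intro v
    rw [Matrix.mulVec_mulVec]
    congr 1
  have hw : ∀ j, Matrix.of X *ᵥ ((Matrix.of X)ᵀ *ᵥ (fun i => U i j)) =
      lam j • (fun i => U i j) := by
    intro j; rw [hXX, hU2]; rfl
  have huu : ∀ j, (fun i => U i j) ⬝ᵥ (fun i => U i j) = 1 := by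
    intro j; have := hU1 j j; simpa [dotProduct] using this
  have hww : ∀ j, ((Matrix.of X)ᵀ *ᵥ (fun i => U i j)) ⬝ᵥ
      ((Matrix.of X)ᵀ *ᵥ (fun i => U i j)) = lam j := by
    intro j
    rw [Matrix.dotProduct_mulVec, Matrix.vecMul_transpose, hw, smul_dotProduct, huu, smul_eq_mul,
      mul_one]
  have hlow : ∀ j, c * n ≤ lam j := by
    intro j
    have := h3 ((Matrix.of X)ᵀ *ᵥ (fun i => U i j))
    rw [hww, hw, smul_dotProduct, dotProduct_smul, huu, smul_eq_mul, smul_eq_mul, mul_one] at this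
    exact le_of_mul_le_mul_right this (hlam j)
  refine dk_det (Matrix.of A) E (Matrix.of U) (Matrix.of Uh) lam lamh (c * n / 2) (c * n / 2)
    (n * d * (s + 1) ^ 2 / (c * n)) (by positivity) ?_ hUm hUhm ?_ ?_ hop ?_ (by positivity)
    ?_ ?_ hn2
  · ext i j; simp [hA i j]
  · ext i j
    have := congrFun (hV2 j) i
    rw [Matrix.mul_diagonal]
    simp only [Matrix.of_apply]
    rw [mul_comm (Uh i j), ← this]
    rfl
  · ext i j
    simp only [Matrix.add_apply, E, Matrix.of_apply, Matrix.mul_apply (N := (Matrix.of U)ᵀ),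
      Matrix.mul_diagonal, Matrix.transpose_apply]
    rw [← hU3 i j]; ring
  · intro mu v hv hAv hvU j
    refine hV3 mu v hv hAv (fun j => ?_) j
    have := congrFun hvU j
    simp only [Matrix.mulVec, dotProduct, Matrix.transpose_apply, Matrix.of_apply,
      Pi.zero_apply] at this
    rw [← this]
    exact Finset.sum_congr rfl fun _ _ => mul_comm _ _
  · intro j; linarith [hlow j]
  · intro j
    have hu : (Matrix.of U)ᵀ j = fun i => U i j := rfl
    rw [hu]
    have hfr := dk_frob_mulVec (E * Matrix.of X) ((Matrix.of X)ᵀ *ᵥ (fun i => U i j))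
    rw [← Matrix.mulVec_mulVec, hw, hww, Matrix.mulVec_smul, smul_dotProduct, dotProduct_smul,
      smul_eq_mul, smul_eq_mul] at hfr
    have hl := hlam j
    have hl2 := hlow j
    set y := (E *ᵥ fun i => U i j) ⬝ᵥ (E *ᵥ fun i => U i j) with hy
    have hy0 : 0 ≤ y := dk_nn _
    have h5 : lam j * y ≤ n * d * (s + 1) ^ 2 := by
      have : lam j * (lam j * y) ≤ lam j * (n * d * (s + 1) ^ 2) := by
        refine hfr.trans ?_
        rw [mul_comm (lam j)]
        exact mul_le_mul_of_nonneg_right hEX hl.le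
      exact le_of_mul_le_mul_left this hl
    rw [le_div_iff₀ (by positivity)]
    nlinarith

theorem dk_pd {d : ℕ} (F : Measure (Fin d → ℝ)) [IsProbabilityMeasure F]
    (hF : InnerProductDistribution d F) (hrank : (secondMoment F).det ≠ 0) :
    ∃ c : ℝ, 0 < c ∧ ∀ w : Fin d → ℝ, c * (w ⬝ᵥ w) ≤ w ⬝ᵥ (secondMoment F *ᵥ w) := by
  have hm : ∀ a b, Measurable fun x : Fin d → ℝ => x a * x b := fun a b =>
    (measurable_pi_apply _).mul (measurable_pi_apply _)
  have hintg : ∀ a b, Integrable (fun x : Fin d → ℝ => x a * x b) F := by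
    intro a b
    refine Integrable.of_bound (hm a b).aestronglyMeasurable 1 ((dk_support F).mono fun x hx => ?_)
    have h1 := dk_coord x (hF.2 x hx x hx).2 a
    have h2 := dk_coord x (hF.2 x hx x hx).2 b
    rw [Real.norm_eq_abs, abs_mul]
    nlinarith [abs_nonneg (x a), abs_nonneg (x b)]
  have hpsd : ∀ w : Fin d → ℝ, 0 ≤ w ⬝ᵥ (secondMoment F *ᵥ w) := by
    intro w
    have : w ⬝ᵥ (secondMoment F *ᵥ w) = ∫ x, (∑ a, w a * x a) ^ 2 ∂F := by
      have e : ∀ x : Fin d → ℝ, (∑ a, w a * x a) ^ 2 = ∑ a, ∑ b, w a * w b * (x a * x b) := by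
        intro x
        rw [sq, Finset.sum_mul_sum]
        exact Finset.sum_congr rfl fun a _ => Finset.sum_congr rfl fun b _ => by ring
      simp_rw [e]
      rw [integral_finsetSum _ fun a _ => integrable_finsetSum _ fun b _ =>
        (hintg a b).const_mul _]
      simp only [dotProduct, Matrix.mulVec, Finset.mul_sum]
      refine Finset.sum_congr rfl fun a _ => ?_
      rw [integral_finsetSum _ fun b _ => (hintg a b).const_mul _]
      refine Finset.sum_congr rfl fun b _ => ?_
      rw [integral_const_mul]
      simp only [secondMoment, Matrix.of_apply]
      ring
    rw [this]
    exact integral_nonneg fun x => sq_nonneg _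
  have hsym : (secondMoment F)ᵀ = secondMoment F := by
    ext a b
    simp only [secondMoment, Matrix.transpose_apply, Matrix.of_apply, mul_comm]
  obtain ⟨V, D, hV1, hV2, hT⟩ := dk_spectral _ hsym
  have hD0 : ∀ j, 0 < D j := by
    intro j
    have hne : D j ≠ 0 := by
      intro h0
      apply hrank
      rw [hT, Matrix.det_mul, Matrix.det_mul, Matrix.det_diagonal,
        Finset.prod_eq_zero (Finset.mem_univ j) h0]
      simp
    have h1 := hpsd (V *ᵥ Pi.single j 1)
    rw [hT, dk_diag_quad, Matrix.mulVec_mulVec, hV1, Matrix.one_mulVec] at h1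
    have h2 : ∑ i, D i * (Pi.single j (1:ℝ) : Fin d → ℝ) i ^ 2 = D j := by
      rw [Finset.sum_eq_single j]
      · simp
      · intro b _ hb; simp [hb]
      · simp
    rw [h2] at h1
    exact lt_of_le_of_ne h1 hne.symm
  obtain ⟨c, hc, hcD⟩ : ∃ c : ℝ, 0 < c ∧ ∀ j, c ≤ D j := by
    rcases isEmpty_or_nonempty (Fin d) with h | h
    · exact ⟨1, one_pos, fun j => (h.false j).elim⟩
    · obtain ⟨j, hj⟩ := Finite.exists_min D
      exact ⟨D j, hD0 j, hj⟩
  refine ⟨c, hc, fun w => ?_⟩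
  rw [hT, dk_diag_quad, dk_orth_sq V w hV2, Finset.mul_sum]
  exact Finset.sum_le_sum fun i _ => mul_le_mul_of_nonneg_right (hcD i) (sq_nonneg _)

theorem dk_gram {d n : ℕ} (X : Fin n → Fin d → ℝ) (Δ : Matrix (Fin d) (Fin d) ℝ) (c s : ℝ)
    (hΔ : ∀ w : Fin d → ℝ, c * (w ⬝ᵥ w) ≤ w ⬝ᵥ (Δ *ᵥ w))
    (h : ∀ a b, |∑ i, (X i a * X i b - Δ a b)| ≤ s) (hs : s * d ≤ c / 2 * n) (hs0 : 0 ≤ s)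
    (w : Fin d → ℝ) :
    c / 2 * n * (w ⬝ᵥ w) ≤ (Matrix.of X *ᵥ w) ⬝ᵥ (Matrix.of X *ᵥ w) := by
  have e : (Matrix.of X *ᵥ w) ⬝ᵥ (Matrix.of X *ᵥ w) - n * (w ⬝ᵥ (Δ *ᵥ w)) =
      ∑ a, ∑ b, w a * w b * ∑ i, (X i a * X i b - Δ a b) := by
    have e1 : (Matrix.of X *ᵥ w) ⬝ᵥ (Matrix.of X *ᵥ w) =
        ∑ a, ∑ b, w a * w b * ∑ i, X i a * X i b := by
      simp only [dotProduct, Matrix.mulVec, Matrix.of_apply, Finset.sum_mul_sum]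
      simp only [Finset.mul_sum]
      rw [Finset.sum_comm]
      refine Finset.sum_congr rfl fun a _ => ?_
      rw [Finset.sum_comm]
      exact Finset.sum_congr rfl fun b _ => Finset.sum_congr rfl fun i _ => by ring
    have e2 : (n : ℝ) * (w ⬝ᵥ (Δ *ᵥ w)) = ∑ a, ∑ b, w a * w b * (n * Δ a b) := by
      simp only [dotProduct, Matrix.mulVec, Finset.mul_sum]
      exact Finset.sum_congr rfl fun b _ => Finset.sum_congr rfl fun i _ => by ring
    rw [e1, e2, ← Finset.sum_sub_distrib]
    refine Finset.sum_congr rfl fun a _ => ?_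
    rw [← Finset.sum_sub_distrib]
    refine Finset.sum_congr rfl fun b _ => ?_
    rw [Finset.sum_sub_distrib]
    simp only [Finset.sum_const, Finset.card_univ, Fintype.card_fin, nsmul_eq_mul]
    ring
  have hb : |∑ a, ∑ b, w a * w b * ∑ i, (X i a * X i b - Δ a b)| ≤ s * (d * (w ⬝ᵥ w)) := by
    have h1 : |∑ a, ∑ b, w a * w b * ∑ i, (X i a * X i b - Δ a b)| ≤
        ∑ a, ∑ b, |w a| * |w b| * s := by
      refine (Finset.abs_sum_le_sum_abs _ _).trans (Finset.sum_le_sum fun a _ => ?_)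
      refine (Finset.abs_sum_le_sum_abs _ _).trans (Finset.sum_le_sum fun b _ => ?_)
      rw [abs_mul, abs_mul]
      exact mul_le_mul_of_nonneg_left (h a b) (by positivity)
    have h2 : ∑ a, ∑ b, |w a| * |w b| * s = (∑ a, |w a|) ^ 2 * s := by
      rw [sq, Finset.sum_mul_sum, Finset.sum_mul]
      exact Finset.sum_congr rfl fun a _ => by rw [Finset.sum_mul]
    have h3 : (∑ a, |w a|) ^ 2 ≤ d * (w ⬝ᵥ w) := by
      have := sq_sum_le_card_mul_sum_sq (s := (Finset.univ : Finset (Fin d))) (f := fun a => |w a|)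
      simpa [dotProduct, sq] using this
    rw [h2] at h1
    nlinarith
  have hlo := (abs_le.mp hb).1
  rw [← e] at hlo
  have hw := dk_nn w
  have h4 := mul_le_mul_of_nonneg_left (hΔ w) (Nat.cast_nonneg (α := ℝ) n)
  have h5 := mul_le_mul_of_nonneg_right hs hw
  nlinarith

/-! ### Probability of the good event and conclusion -/

theorem dk_dotd_meas {d n : ℕ} (i j : Fin n) :
    Measurable fun p : ((Fin n × Fin n) → ℝ) × (Fin n → Fin d → ℝ) => dotd (p.2 i) (p.2 j) := by
  unfold dotd
  fun_prop

theorem dk_adj_meas {d n : ℕ} (i j : Fin n) :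
    Measurable fun p : ((Fin n × Fin n) → ℝ) × (Fin n → Fin d → ℝ) => adjOf 1 p.2 p.1 i j := by
  unfold adjOf
  by_cases h : i = j
  · simp only [h, if_true]; exact measurable_const
  · simp only [h, if_false, one_mul]
    refine Measurable.ite (measurableSet_lt ?_ (dk_dotd_meas i j)) measurable_const measurable_const
    fun_prop

/-- A set whose almost every section is small is small. -/
theorem dk_section {α β : Type*} [MeasurableSpace α] [MeasurableSpace β] (μ : Measure α)
    (ν : Measure β) [IsProbabilityMeasure μ] [IsProbabilityMeasure ν] (T : Set (α × β))
    (hT : MeasurableSet T) (b : ℝ≥0∞) (h : ∀ᵐ y ∂ν, μ ((fun x => (x, y)) ⁻¹' T) ≤ b) :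
    (μ.prod ν) T ≤ b := by
  rw [Measure.prod_apply_symm hT]
  refine (lintegral_mono_ae h).trans ?_
  simp

theorem dk_bad {d n : ℕ} (F : Measure (Fin d → ℝ)) [IsProbabilityMeasure F]
    (hF : InnerProductDistribution d F) (s : ℝ) (hs : 0 < s) :
    ((pairUniform n).prod (Measure.pi fun _ : Fin n => F))
      {p | ¬ ((∀ i, p.2 i ∈ msupport F) ∧
        (∀ i j, i ≠ j → |∑ k ∈ (Finset.univ.erase i).erase j,
          (adjOf 1 p.2 p.1 i k - dotd (p.2 i) (p.2 k)) *
            (adjOf 1 p.2 p.1 k j - dotd (p.2 k) (p.2 j))| ≤ s) ∧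
        (∀ i a, |∑ j ∈ Finset.univ.erase i,
          (adjOf 1 p.2 p.1 i j - dotd (p.2 i) (p.2 j)) * p.2 j a| ≤ s) ∧
        (∀ a b, |∑ i, (p.2 i a * p.2 i b - secondMoment F a b)| ≤ s))} ≤
      ENNReal.ofReal (((n : ℝ) ^ 2 + n * d + d ^ 2) * (2 * Real.exp (-s ^ 2 / (8 * n)))) := by
  set b := 2 * Real.exp (-s ^ 2 / (8 * n)) with hb
  have hb0 : 0 ≤ b := by positivity
  clear_value b
  set ν := Measure.pi fun _ : Fin n => F with hν
  set μ := (pairUniform n).prod ν with hμ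
  let B0 : Set (((Fin n × Fin n) → ℝ) × (Fin n → Fin d → ℝ)) := {p | ¬ ∀ i, p.2 i ∈ msupport F}
  let B1 : Fin n → Fin n → Set (((Fin n × Fin n) → ℝ) × (Fin n → Fin d → ℝ)) := fun i j =>
    {p | i ≠ j ∧ s ≤ |∑ k ∈ (Finset.univ.erase i).erase j,
          (adjOf 1 p.2 p.1 i k - dotd (p.2 i) (p.2 k)) *
            (adjOf 1 p.2 p.1 k j - dotd (p.2 k) (p.2 j))|}
  let B2 : Fin n → Fin d → Set (((Fin n × Fin n) → ℝ) × (Fin n → Fin d → ℝ)) := fun i a =>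
    {p | s ≤ |∑ j ∈ Finset.univ.erase i,
          (adjOf 1 p.2 p.1 i j - dotd (p.2 i) (p.2 j)) * p.2 j a|}
  let B3 : Fin d → Fin d → Set (((Fin n × Fin n) → ℝ) × (Fin n → Fin d → ℝ)) := fun a b =>
    {p | s ≤ |∑ i, (p.2 i a * p.2 i b - secondMoment F a b)|}
  have hsub : {p : ((Fin n × Fin n) → ℝ) × (Fin n → Fin d → ℝ) |
      ¬ ((∀ i, p.2 i ∈ msupport F) ∧
        (∀ i j, i ≠ j → |∑ k ∈ (Finset.univ.erase i).erase j,
          (adjOf 1 p.2 p.1 i k - dotd (p.2 i) (p.2 k)) *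
            (adjOf 1 p.2 p.1 k j - dotd (p.2 k) (p.2 j))| ≤ s) ∧
        (∀ i a, |∑ j ∈ Finset.univ.erase i,
          (adjOf 1 p.2 p.1 i j - dotd (p.2 i) (p.2 j)) * p.2 j a| ≤ s) ∧
        (∀ a b, |∑ i, (p.2 i a * p.2 i b - secondMoment F a b)| ≤ s))} ⊆
      B0 ∪ ((⋃ i, ⋃ j, B1 i j) ∪ ((⋃ i, ⋃ a, B2 i a) ∪ (⋃ a, ⋃ b, B3 a b))) := by
    intro p hp
    by_contra hc
    simp only [Set.mem_union, not_or, Set.mem_iUnion, not_exists] at hc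
    obtain ⟨h0, h1, h2, h3⟩ := hc
    refine hp ⟨not_not.mp h0, fun i j hij => ?_, fun i a => ?_, fun a b => ?_⟩
    · exact (not_le.mp fun h => h1 i j ⟨hij, h⟩).le
    · exact (not_le.mp fun h => h2 i a h).le
    · exact (not_le.mp fun h => h3 a b h).le
  have hsupp : ∀ᵐ X ∂ν, ∀ i j, 0 ≤ dotd (X i) (X j) ∧ dotd (X i) (X j) ≤ 1 :=
    (dk_support_pi F).mono fun X hX i j => hF.2 _ (hX i) _ (hX j)
  have hB0 : μ B0 = 0 := by
    have := (Measure.quasiMeasurePreserving_snd (μ := pairUniform n) (ν := ν)).ae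
      (dk_support_pi (n := n) F)
    exact ae_iff.mp this
  have hB1 : ∀ i j, μ (B1 i j) ≤ ENNReal.ofReal b := by
    intro i j
    by_cases hij : i = j
    · have : B1 i j = ∅ := by
        ext p; simp [B1, hij]
      rw [this]; simp
    · refine dk_section _ _ _ ?_ _ (hsupp.mono fun X hX => ?_)
      · have : B1 i j = {p | s ≤ |∑ k ∈ (Finset.univ.erase i).erase j,
          (adjOf 1 p.2 p.1 i k - dotd (p.2 i) (p.2 k)) *
            (adjOf 1 p.2 p.1 k j - dotd (p.2 k) (p.2 j))|} := by
          ext p; simp [B1, hij]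
        rw [this]
        refine measurableSet_le measurable_const (Measurable.abs ?_)
        exact Finset.measurable_fun_sum _ fun k _ => ((dk_adj_meas i k).sub (dk_dotd_meas i k)).mul
          ((dk_adj_meas k j).sub (dk_dotd_meas k j))
      · refine (measure_mono ?_).trans (hb ▸ dk_tail1 X hX i j hij s hs)
        intro u hu
        exact hu.2
  have hB2 : ∀ i a, μ (B2 i a) ≤ ENNReal.ofReal b := by
    intro i a
    refine dk_section _ _ _ ?_ _ (hsupp.mono fun X hX => hb ▸ dk_tail2 X hX i a s hs)
    refine measurableSet_le measurable_const (Measurable.abs ?_)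
    refine Finset.measurable_fun_sum _ fun k _ => ((dk_adj_meas i k).sub (dk_dotd_meas i k)).mul ?_
    fun_prop
  have hB3 : ∀ a a', μ (B3 a a') ≤ ENNReal.ofReal b := by
    intro a a'
    refine le_trans ?_ (hb ▸ dk_tail3 F hF a a' s hs)
    have := Measure.le_map_apply (μ := μ) (f := Prod.snd) measurable_snd.aemeasurable
      {X | s ≤ |∑ i, (X i a * X i a' - secondMoment F a a')|}
    refine this.trans (le_of_eq ?_)
    rw [hμ, (measurePreserving_snd (μ := pairUniform n) (ν := ν)).map_eq]
  have hU : ∀ {m k : ℕ} (B : Fin m → Fin k → Set (((Fin n × Fin n) → ℝ) × (Fin n → Fin d → ℝ))),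
      (∀ i j, μ (B i j) ≤ ENNReal.ofReal b) →
      μ (⋃ i, ⋃ j, B i j) ≤ ENNReal.ofReal ((m : ℝ) * k * b) := by
    intro m k B hB
    refine (measure_iUnion_le _).trans ?_
    rw [tsum_fintype]
    have : ∀ i, μ (⋃ j, B i j) ≤ ENNReal.ofReal (k * b) := by
      intro i
      refine (measure_iUnion_le _).trans ?_
      rw [tsum_fintype]
      refine (Finset.sum_le_sum fun j _ => hB i j).trans ?_
      rw [ENNReal.ofReal_mul (by positivity)]
      simp
    refine (Finset.sum_le_sum fun j _ => this j).trans ?_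
    rw [mul_assoc, ENNReal.ofReal_mul (by positivity : (0:ℝ) ≤ m)]
    simp
  have e : ((n : ℝ) ^ 2 + n * d + d ^ 2) * b = (n : ℝ) * n * b + ((n : ℝ) * d * b + (d : ℝ) * d * b) := by
    ring
  rw [e, ENNReal.ofReal_add (by positivity) (by positivity),
    ENNReal.ofReal_add (by positivity) (by positivity)]
  refine (measure_mono hsub).trans ?_
  refine (measure_union_le _ _).trans ?_
  rw [hB0, zero_add]
  refine (measure_union_le _ _).trans (add_le_add (hU B1 hB1) ?_)
  exact (measure_union_le _ _).trans (add_le_add (hU B2 hB2) (hU B3 hB3))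

theorem dk_log_small (ε : ℝ) (hε : 0 < ε) : ∀ᶠ n : ℕ in atTop, Real.log n ≤ ε * n := by
  have h := (Real.isLittleO_log_id_atTop.bound hε).natCast_atTop
  filter_upwards [h] with n hn
  have h2 : ‖id (n : ℝ)‖ = n := by simp
  rw [h2] at hn
  exact (le_abs_self _).trans hn

theorem dk_arith (d : ℕ) (c : ℝ) (hc : 0 < c) : ∀ᶠ n : ℕ in atTop,
    0 < n ∧ ∃ s : ℝ, 0 < s ∧ s ^ 2 = 32 * n * Real.log n ∧ s * d ≤ c * n ∧
      (n * (s + 2)) ^ 2 + (n : ℝ) ^ 3 ≤ (c * n / 2) ^ 4 ∧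
      (d : ℝ) * ((n * d * (s + 1) ^ 2 / (c * n)) / (c * n / 2) ^ 2) < 1 ∧
      2 * ((d : ℝ) * ((n * d * (s + 1) ^ 2 / (c * n)) / (c * n / 2) ^ 2)) ≤
        1024 * d ^ 2 / c ^ 3 * (Real.log n / n) := by
  have hl : ∀ᶠ n : ℕ in atTop, (1 : ℝ) ≤ Real.log n :=
    (Real.tendsto_log_atTop.comp tendsto_natCast_atTop_atTop).eventually_ge_atTop 1
  filter_upwards [hl, eventually_ge_atTop 1, dk_log_small (c ^ 2 / (32 * (d ^ 2 + 1))) (by positivity),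
    dk_log_small (c ^ 4 / 4096) (by positivity),
    dk_log_small (c ^ 3 / (512 * (d ^ 2 + 1))) (by positivity),
    (tendsto_natCast_atTop_atTop (R := ℝ)).eventually_ge_atTop (32 / c ^ 4)] with
    n hl hn h1 h2 h3 h4
  have hnR : (1 : ℝ) ≤ n := by exact_mod_cast hn
  have hn0 : (0 : ℝ) < n := by linarith
  set l := Real.log n with hldef
  have hsq : (Real.sqrt (32 * n * l)) ^ 2 = 32 * n * l := Real.sq_sqrt (by positivity)
  set s := Real.sqrt (32 * n * l) with hs
  have hs0 : 0 ≤ s := Real.sqrt_nonneg _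
  have hs2 : 2 ≤ s := by
    rw [hs]; apply Real.le_sqrt_of_sq_le; nlinarith
  have hd0 : (0 : ℝ) ≤ (d : ℝ) ^ 2 := by positivity
  have h12 : (s + 1) ^ 2 ≤ 128 * n * l := by nlinarith
  have hE : (d : ℝ) * ((n * d * (s + 1) ^ 2 / (c * n)) / (c * n / 2) ^ 2) =
      4 * d ^ 2 * (s + 1) ^ 2 / (c ^ 3 * n ^ 2) := by
    field_simp; norm_num
  have hF : 4 * (d : ℝ) ^ 2 * (s + 1) ^ 2 / (c ^ 3 * n ^ 2) ≤ 512 * d ^ 2 / c ^ 3 * (l / n) := by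
    rw [div_le_iff₀ (by positivity)]
    have : 512 * (d : ℝ) ^ 2 / c ^ 3 * (l / n) * (c ^ 3 * n ^ 2) = 4 * d ^ 2 * (128 * n * l) := by
      field_simp; ring
    rw [this]
    exact mul_le_mul_of_nonneg_left h12 (by positivity)
  refine ⟨by omega, s, by linarith, hsq, ?_, ?_, ?_, ?_⟩
  · refine (abs_le_of_sq_le_sq' ?_ (by positivity)).2
    rw [mul_pow, hsq]
    rw [div_mul_eq_mul_div, le_div_iff₀ (by positivity)] at h1
    have h5 : 32 * d ^ 2 * l ≤ c ^ 2 * n := by nlinarith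
    nlinarith [mul_le_mul_of_nonneg_left h5 hn0.le]
  · have h5 : (s + 2) ^ 2 ≤ 128 * n * l := by nlinarith
    have h6 : 128 * n * l ≤ c ^ 4 / 32 * n ^ 2 := by nlinarith [mul_le_mul_of_nonneg_left h2 hn0.le]
    have h7 : (1 : ℝ) ≤ c ^ 4 / 32 * n := by
      rw [div_le_iff₀ (by positivity)] at h4; linarith
    have h8 : (n : ℝ) ^ 3 ≤ c ^ 4 / 32 * n ^ 4 := by
      nlinarith [mul_le_mul_of_nonneg_left h7 (by positivity : (0:ℝ) ≤ n ^ 3)]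
    have h9 := mul_le_mul_of_nonneg_left (h5.trans h6) (by positivity : (0:ℝ) ≤ n ^ 2)
    calc _ = (n : ℝ) ^ 2 * (s + 2) ^ 2 + n ^ 3 := by ring
      _ ≤ (n : ℝ) ^ 2 * (c ^ 4 / 32 * n ^ 2) + c ^ 4 / 32 * n ^ 4 := add_le_add h9 h8
      _ = _ := by ring
  · rw [hE]
    refine hF.trans_lt ?_
    rw [div_mul_eq_mul_div, le_div_iff₀ (by positivity)] at h3
    rw [div_mul_div_comm, div_lt_one (by positivity)]
    nlinarith
  · rw [hE]
    have : 1024 * (d : ℝ) ^ 2 / c ^ 3 * (l / n) = 2 * (512 * d ^ 2 / c ^ 3 * (l / n)) := by ring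
    rw [this]; linarith

/-- modified Davis–Kahan bound: for all suitably large `n`, with
probability at least `1 − C n⁻²` there exists an orthogonal matrix `Q` with
`‖ÛQ − U‖_F ≤ C log^{1/2} n / √n`. -/
theorem davis_kahan_modified
    {d : ℕ} (F : Measure (Fin d → ℝ)) [IsProbabilityMeasure F]
    (hF : InnerProductDistribution d F) (hrank : (secondMoment F).det ≠ 0) :
    ∃ C : ℝ, 0 < C ∧ ∀ᶠ n : ℕ in atTop,
      ENNReal.ofReal (1 - C / (n : ℝ) ^ 2) ≤
        rdpgLaw d n F
          {p | ∀ (U Uh : Fin n → Fin d → ℝ) (lam lamh : Fin d → ℝ),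
            IsSpecDecomp (fun i i' => dotd (p.2 i) (p.2 i')) U lam → (∀ j, 0 < lam j) →
            IsTopSpec p.1 Uh lamh →
            ∃ Q : Matrix (Fin d) (Fin d) ℝ, Qᵀ * Q = 1 ∧
              frobNorm (Matrix.of Uh * Q - Matrix.of U) ≤
                C * Real.sqrt (Real.log n) / Real.sqrt n} := by
  obtain ⟨c0, hc0, hpd⟩ := dk_pd F hF hrank
  set c := c0 / 2 with hcdef
  have hc : 0 < c := by positivity
  set K := Real.sqrt (1024 * d ^ 2 / c ^ 3) with hK
  have hK0 : 0 ≤ K := Real.sqrt_nonneg _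
  refine ⟨2 + 2 * d + 2 * d ^ 2 + K, by positivity, ?_⟩
  filter_upwards [dk_arith d c hc] with n hn
  obtain ⟨hn, s, hs, hs2, hsd, hn1, hn2, hn3⟩ := hn
  have hnR : (1 : ℝ) ≤ n := by exact_mod_cast hn
  have hn0 : (0 : ℝ) < n := by linarith
  have hbad := dk_bad (n := n) F hF s hs
  have hexp : Real.exp (-s ^ 2 / (8 * n)) = 1 / (n : ℝ) ^ 4 := by
    rw [hs2]
    have : -(32 * (n : ℝ) * Real.log n) / (8 * n) = -(Real.log ((n : ℝ) ^ 4)) := by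
      rw [Real.log_pow]; push_cast; field_simp; ring
    rw [this, Real.exp_neg, Real.exp_log (by positivity), one_div]
  rw [hexp] at hbad
  set μ := (pairUniform n).prod (Measure.pi fun _ : Fin n => F) with hμ
  have hmeas : Measurable fun p : ((Fin n × Fin n) → ℝ) × (Fin n → Fin d → ℝ) =>
      (adjOf 1 p.2 p.1, p.2) := by
    refine Measurable.prodMk ?_ measurable_snd
    exact measurable_pi_lambda _ fun i => measurable_pi_lambda _ fun j => dk_adj_meas i j
  unfold rdpgLaw rdpgLawOf
  refine le_trans ?_ (Measure.le_map_apply hmeas.aemeasurable _)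
  rw [← hμ]
  have hbb : ((n : ℝ) ^ 2 + n * d + d ^ 2) * (2 * (1 / (n : ℝ) ^ 4)) ≤
      (2 + 2 * d + 2 * d ^ 2 + K) / (n : ℝ) ^ 2 := by
    have h1 : (n : ℝ) ^ 2 + n * d + d ^ 2 ≤ n ^ 2 * (1 + d + d ^ 2) := by
      have a1 : (n : ℝ) ≤ n ^ 2 := by nlinarith
      have a2 : (1 : ℝ) ≤ n ^ 2 := by nlinarith
      have a3 := mul_le_mul_of_nonneg_right a1 (Nat.cast_nonneg (α := ℝ) d)
      have a4 := mul_le_mul_of_nonneg_right a2 (sq_nonneg (d : ℝ))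
      nlinarith
    calc _ ≤ (n : ℝ) ^ 2 * (1 + d + d ^ 2) * (2 * (1 / (n : ℝ) ^ 4)) :=
          mul_le_mul_of_nonneg_right h1 (by positivity)
      _ = (2 + 2 * d + 2 * d ^ 2) / (n : ℝ) ^ 2 := by field_simp
      _ ≤ _ := div_le_div_of_nonneg_right (by linarith) (by positivity)
  rw [ENNReal.ofReal_sub _ (by positivity), ENNReal.ofReal_one, tsub_le_iff_right]
  refine le_trans ?_ (add_le_add le_rfl (hbad.trans (ENNReal.ofReal_le_ofReal hbb)))
  rw [← measure_univ (μ := μ)]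
  refine le_trans (measure_mono ?_) (measure_union_le _ _)
  intro p _
  rw [Set.mem_union, or_iff_not_imp_right]
  intro hp
  simp only [Set.mem_ofPred_eq, not_not] at hp
  obtain ⟨h0, h1, h2, h3⟩ := hp
  have hX : ∀ i j, 0 ≤ dotd (p.2 i) (p.2 j) ∧ dotd (p.2 i) (p.2 j) ≤ 1 :=
    fun i j => hF.2 _ (h0 i) _ (h0 j)
  intro U Uh lam lamh hU hlam hUh
  obtain ⟨Q, hQ, hfr⟩ := dk_good (adjOf 1 p.2 p.1) p.2 s c hs.le hc hn
    (fun i j => by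
      unfold adjOf
      rw [min_comm, max_comm, dk_dotd_comm]
      simp only [eq_comm])
    (fun i j => by
      have := hX i j
      unfold adjOf
      rw [abs_le]
      split_ifs <;> constructor <;> linarith)
    (fun i a => dk_coord _ (hX i i).2 a) h1 h2
    (dk_gram p.2 (secondMoment F) c0 s hpd h3 hsd hs.le) hn1 hn2 U Uh lam lamh hU hlam hUh
  refine ⟨Q, hQ, ?_⟩
  unfold frobNorm
  refine (Real.sqrt_le_sqrt (hfr.trans hn3)).trans ?_
  rw [Real.sqrt_mul (by positivity), Real.sqrt_div (Real.log_nonneg hnR), ← hK, mul_div_assoc]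
  refine mul_le_mul_of_nonneg_right ?_ (by positivity)
  have : (0:ℝ) ≤ 2 + 2 * d + 2 * d ^ 2 := by positivity
  linarith

end
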